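/- arXiv:1605.08731 — 2 statements merged into one kernel-verified Lean document; each statement's English description precedes it below -/
import Mathlib

section
/- Let X ⊂ int(𝔸) be an f-invariant essential annular continuum. Suppose ρ₋ ∈ ℝ is the lower prime end rotation number of the lift f̃ in X, in the sense that for all points x, y ∈ X̃ accessible from Ũ₋ one has k₋(f̃ⁿ(x), y)/n → ρ₋ as n → ∞. Then ρ₋ ∈ ρ_mes(f̃, X), i.e. there is an f-invariant Borel probability measure μ with supp(μ) ⊂ X and ρ(f̃, μ) = ρ₋. -/
open Set Function MeasureTheory Filter Topology

noncomputable section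

/-- The vertical fiber `[-1,1]`. -/
abbrev II : Set ℝ := Set.Icc (-1 : ℝ) 1

/-- The universal cover `ℝ × [-1,1]` of the annulus. -/
abbrev Strip : Type := ℝ × II

/-- The compact annulus `(ℝ/ℤ) × [-1,1]`. -/
abbrev Ann : Type := AddCircle (1 : ℝ) × II

/-- The covering projection `π`. -/
def pr (z : Strip) : Ann := ((z.1 : AddCircle (1 : ℝ)), z.2)

/-- The deck transformation `T^k`. -/
def shiftPt (k : ℤ) (z : Strip) : Strip := (z.1 + k, z.2)

/-- `S + k`, the image of `S` under `T^k`. -/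
def shiftSet (k : ℤ) (S : Set Strip) : Set Strip := shiftPt k '' S

/-- `f` is isotopic to the identity. -/
def IsotopicToId (f : Ann → Ann) : Prop :=
  ∃ H : ℝ → Ann → Ann, Continuous (fun p : ℝ × Ann => H p.1 p.2) ∧
    (∀ t : ℝ, Function.Bijective (H t)) ∧ H 0 = id ∧ H 1 = f

/-- `F` is a lift of `f` commuting with the deck transformation. -/
def IsLift (f : Ann → Ann) (F : Strip → Strip) : Prop :=
  (∀ z, pr (F z) = f (pr z)) ∧ (∀ z, F (shiftPt 1 z) = shiftPt 1 (F z))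

/-- `X` is an essential annular continuum with complementary components `Um`, `Up`. -/
structure IsEAC (X Um Up : Set Ann) : Prop where
  compact : IsCompact X
  connected : IsConnected X
  inInterior : ∀ p ∈ X, ((p.2 : ℝ)) ∈ Set.Ioo (-1 : ℝ) 1
  hUm : Um = connectedComponentIn Xᶜ ((0 : AddCircle (1 : ℝ)), ⟨-1, le_rfl, by norm_num⟩)
  hUp : Up = connectedComponentIn Xᶜ ((0 : AddCircle (1 : ℝ)), ⟨1, by norm_num, le_rfl⟩)
  cover : Xᶜ = Um ∪ Up
  ne : Um ≠ Up

/-- An arc `γ : [0,1] → U ∪ {p}` with `γ([0,1)) ⊂ U` and `γ(1) = p`. -/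
def IsArcTo (U : Set Strip) (γ : unitInterval → Strip) (p : Strip) : Prop :=
  Continuous γ ∧ Function.Injective γ ∧ (∀ t, t ≠ 1 → γ t ∈ U) ∧ γ 1 = p

/-- `p` is accessible from `U`. -/
def AccFrom (U : Set Strip) (p : Strip) : Prop := ∃ γ, IsArcTo U γ p

/-- The order `≺` on accessible points, with access arcs starting on `ℝ × {b}`. -/
def PrecB (b : ℝ) (U : Set Strip) (x x' : Strip) : Prop :=
  ∃ γ γ' : unitInterval → Strip,
    IsArcTo U γ x ∧ IsArcTo U γ' x' ∧
    ((γ 0).2 : ℝ) = b ∧ ((γ' 0).2 : ℝ) = b ∧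
    Disjoint (range γ) (range γ') ∧ (γ 0).1 < (γ' 0).1

/-- `k = k(x,y)` is the unique integer with `T^k(y) ⪯ x ≺ T^{k+1}(y)`. -/
def AccIdxB (b : ℝ) (U : Set Strip) (x y : Strip) (k : ℤ) : Prop :=
  (shiftPt k y = x ∨ PrecB b U (shiftPt k y) x) ∧ PrecB b U x (shiftPt (k + 1) y)

/-- `ρ` is the prime end rotation number of the lift `F` as seen from `U`
(access arcs starting at height `b`): `k(Fⁿ(x), y)/n → ρ` for all accessible `x, y`. -/
def PrimeEndRotB (b : ℝ) (U Xt : Set Strip) (F : Strip → Strip) (ρ : ℝ) : Prop :=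
  ∀ x ∈ Xt, ∀ y ∈ Xt, AccFrom U x → AccFrom U y →
    ∀ k : ℕ → ℤ, (∀ n : ℕ, AccIdxB b U (F^[n] x) y (k n)) →
      Tendsto (fun n : ℕ => (k n : ℝ) / (n : ℝ)) atTop (𝓝 ρ)

/-- The measure-theoretic rotation set `ρ_mes(g̃, X)`, where `φ` is the displacement
function of the lift `g̃` (pushed down to the annulus). -/
def rotMes (g : Ann → Ann) (φ : Ann → ℝ) (X : Set Ann) : Set ℝ :=
  {r | ∃ μ : Measure Ann, IsProbabilityMeasure μ ∧ Measure.map g μ = μ ∧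
    μ Xᶜ = 0 ∧ ∫ a, φ a ∂μ = r}

/-- A point in the interior of the top boundary segment `(0,1) × {1}`. -/
def topSeg : Strip := ((1 : ℝ) / 2, ⟨1, by norm_num, le_rfl⟩)

/-- `β' = β ∖ {x₀} = {0} × (η, 1]`. -/
def betaP (η : ℝ) : Set Strip := {z : Strip | z.1 = 0 ∧ η < (z.2 : ℝ)}

/-- `η = max{y : (0,y) ∈ X̃}`. -/
def etaSpec (Xt : Set Strip) (η : ℝ) : Prop :=
  IsGreatest {y : ℝ | ∃ z ∈ Xt, z.1 = 0 ∧ (z.2 : ℝ) = y} η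

/-- The fundamental region `V`: the closure, relative to `Ũ₊`, of the connected
component of `Ũ₊ ∖ (β' ∪ (β' + 1))` containing the segment `(0,1) × {1}`. -/
def Vset (Utp : Set Strip) (η : ℝ) : Set Strip :=
  Utp ∩ closure (connectedComponentIn (Utp \ (betaP η ∪ shiftSet 1 (betaP η))) topSeg)

/-- A hair of `W`: an arc in `W` starting on `ℝ × {1}`. -/
def IsHair (W : Set Strip) (γ : unitInterval → Strip) : Prop :=
  Continuous γ ∧ Function.Injective γ ∧ ((γ 0).2 : ℝ) = 1 ∧ ∀ t, γ t ∈ W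

/-- `(γ)₁`, the projection of the image of `γ` to the first coordinate. -/
def proj1 (γ : unitInterval → Strip) : Set ℝ := range fun t => (γ t).1

/-- `(V + k)⁻ = ⋃_{j ≤ k} (V + j)`. -/
def VMinus (k : ℤ) (V : Set Strip) : Set Strip := ⋃ j ∈ Iic k, shiftSet j V

/-- `(V + k)⁺ = ⋃_{j ≥ k} (V + j)`. -/
def VPlus (k : ℤ) (V : Set Strip) : Set Strip := ⋃ j ∈ Ici k, shiftSet j V

/-- A crosscut of `Ũ₊`: an arc with endpoints on `X̃` and interior in `Ũ₊`. -/
def IsCrosscut (Utp Xt : Set Strip) (c : unitInterval → Strip) : Prop :=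
  Continuous c ∧ Function.Injective c ∧ c 0 ∈ Xt ∧ c 1 ∈ Xt ∧
    ∀ t, t ≠ 0 → t ≠ 1 → c t ∈ Utp

/-- `F^n` for `n : ℤ`. -/
def iterZ (F : Strip ≃ₜ Strip) (n : ℤ) : Strip → Strip := fun z => (F.toEquiv ^ n) z

end

/-- Point of the strip with prescribed coordinates. -/
noncomputable def pt (x y : ℝ) : Strip := (x, projIcc (-1) 1 (by norm_num) y)

lemma pt_fst (x y : ℝ) : (pt x y).1 = x := rfl

lemma pt_snd (x : ℝ) {y : ℝ} (h1 : -1 ≤ y) (h2 : y ≤ 1) : ((pt x y).2 : ℝ) = y := by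
  unfold pt
  rw [projIcc_of_mem _ (⟨h1, h2⟩ : y ∈ Icc (-1 : ℝ) 1)]

lemma pt_self (z : Strip) : pt z.1 z.2 = z := by
  unfold pt
  rw [projIcc_val]

lemma snd_ge (z : Strip) : -1 ≤ (z.2 : ℝ) := z.2.2.1
lemma snd_le (z : Strip) : (z.2 : ℝ) ≤ 1 := z.2.2.2

lemma strip_ext {z w : Strip} (h1 : z.1 = w.1) (h2 : (z.2 : ℝ) = w.2) : z = w :=
  Prod.ext h1 (Subtype.ext h2)

lemma continuous_pt {α : Type*} [TopologicalSpace α] {u v : α → ℝ} (hu : Continuous u)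
    (hv : Continuous v) : Continuous (fun a => pt (u a) (v a)) :=
  hu.prodMk (continuous_projIcc.comp hv)

lemma continuous_h : Continuous (fun z : Strip => (z.2 : ℝ)) :=
  continuous_subtype_val.comp continuous_snd

lemma continuous_pr : Continuous pr :=
  ((AddCircle.continuous_mk' (1 : ℝ)).comp continuous_fst).prodMk continuous_snd

lemma isOpenMap_pr : IsOpenMap pr :=
  IsOpenMap.prodMap (f := fun x : ℝ => (x : AddCircle (1:ℝ))) (g := fun y : II => y)
    (QuotientAddGroup.isOpenMap_coe) IsOpenMap.id

lemma continuous_shiftPt (k : ℤ) : Continuous (shiftPt k) :=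
  (continuous_fst.add continuous_const).prodMk continuous_snd

lemma shiftPt_zero (z : Strip) : shiftPt 0 z = z := by simp [shiftPt]

lemma shiftPt_add (k l : ℤ) (z : Strip) : shiftPt k (shiftPt l z) = shiftPt (k + l) z := by
  simp [shiftPt]; ring

lemma shiftPt_pt (k : ℤ) (x y : ℝ) : shiftPt k (pt x y) = pt (x + k) y := rfl

lemma shiftPt_injective (k : ℤ) : Injective (shiftPt k) := by
  intro a b h
  have := congrArg (shiftPt (-k)) h
  simpa [shiftPt_add, shiftPt_zero] using this

lemma pr_shiftPt (k : ℤ) (z : Strip) : pr (shiftPt k z) = pr z := by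
  unfold pr shiftPt
  ext1
  · show ((z.1 + (k : ℝ) : ℝ) : AddCircle (1:ℝ)) = z.1
    have := AddCircle.coe_add_period (1:ℝ)
    have h2 : ((k : ℝ) : AddCircle (1:ℝ)) = 0 := by
      rw [AddCircle.coe_eq_zero_iff]
      exact ⟨k, by simp⟩
    rw [AddCircle.coe_add, h2, add_zero]
  · rfl

lemma pr_eq_iff {z w : Strip} : pr z = pr w ↔ ∃ k : ℤ, w = shiftPt k z := by
  constructor
  · intro h
    have h1 : ((w.1 : ℝ) : AddCircle (1:ℝ)) = z.1 := (congrArg Prod.fst h).symm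
    have h2 : z.2 = w.2 := congrArg (fun a : Ann => a.2) h
    rw [← sub_eq_zero, ← AddCircle.coe_sub, AddCircle.coe_eq_zero_iff] at h1
    obtain ⟨k, hk⟩ := h1
    refine ⟨k, Prod.ext ?_ h2.symm⟩
    simp [shiftPt] at hk ⊢
    linarith
  · rintro ⟨k, rfl⟩
    exact (pr_shiftPt k z).symm

lemma pr_surjective : Surjective pr := by
  rintro ⟨a, b⟩
  obtain ⟨x, rfl⟩ := QuotientAddGroup.mk_surjective a
  exact ⟨(x, b), rfl⟩

lemma mem_shift {S : Set Ann} (k : ℤ) {z : Strip} : shiftPt k z ∈ pr ⁻¹' S ↔ z ∈ pr ⁻¹' S := by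
  simp [pr_shiftPt]

lemma lift_shift {f : Ann → Ann} {F : Strip → Strip} (hF : IsLift f F) (k : ℤ) (z : Strip) :
    F (shiftPt k z) = shiftPt k (F z) := by
  have hn : ∀ n : ℕ, ∀ z, F (shiftPt n z) = shiftPt n (F z) := by
    intro n
    induction n with
    | zero => intro z; simp [shiftPt_zero]
    | succ n ih =>
      intro z
      have : ((n + 1 : ℕ) : ℤ) = 1 + (n : ℤ) := by push_cast; ring
      rw [this, ← shiftPt_add, hF.2, ih, shiftPt_add]
  obtain ⟨n, rfl | rfl⟩ := k.eq_nat_or_neg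
  · exact hn n z
  · apply shiftPt_injective n
    rw [← hn, shiftPt_add, shiftPt_add]
    simp [shiftPt_zero]

lemma iter_shift {f : Ann → Ann} {F : Strip → Strip} (hF : IsLift f F) (n : ℕ) (k : ℤ)
    (z : Strip) : F^[n] (shiftPt k z) = shiftPt k (F^[n] z) := by
  induction n generalizing z with
  | zero => rfl
  | succ n ih => rw [iterate_succ_apply, iterate_succ_apply, lift_shift hF, ih]

/-- straight segment -/
noncomputable def seg (z w : Strip) (t : ℝ) : Strip :=
  pt (z.1 + t * (w.1 - z.1)) (z.2 + t * (w.2 - z.2))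

lemma seg_fst (z w : Strip) (t : ℝ) : (seg z w t).1 = z.1 + t * (w.1 - z.1) := rfl

lemma seg_snd (z w : Strip) {t : ℝ} (h0 : 0 ≤ t) (h1 : t ≤ 1) :
    ((seg z w t).2 : ℝ) = z.2 + t * (w.2 - z.2) := by
  apply pt_snd
  · nlinarith [snd_ge z, snd_ge w]
  · nlinarith [snd_le z, snd_le w]

lemma continuous_seg (z w : Strip) : Continuous (seg z w) := by
  apply continuous_pt <;> fun_prop

lemma seg_zero (z w : Strip) : seg z w 0 = z := by
  simp [seg, pt_self]

lemma seg_one (z w : Strip) : seg z w 1 = w := by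
  simp [seg, pt_self]

lemma seg_inj {z w : Strip} (h : z ≠ w) {s t : ℝ} (hs : s ∈ Icc (0:ℝ) 1) (ht : t ∈ Icc (0:ℝ) 1)
    (e : seg z w s = seg z w t) : s = t := by
  have e1 : (seg z w s).1 = (seg z w t).1 := by rw [e]
  have e2 : ((seg z w s).2 : ℝ) = (seg z w t).2 := by rw [e]
  rw [seg_fst, seg_fst] at e1
  rw [seg_snd _ _ hs.1 hs.2, seg_snd _ _ ht.1 ht.2] at e2
  by_contra hne
  have hst : s - t ≠ 0 := sub_ne_zero.2 hne
  apply h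
  apply strip_ext
  · have : (s - t) * (w.1 - z.1) = 0 := by linarith
    rcases mul_eq_zero.1 this with h | h
    · exact absurd h hst
    · linarith
  · have : (s - t) * ((w.2:ℝ) - z.2) = 0 := by linarith
    rcases mul_eq_zero.1 this with h | h
    · exact absurd h hst
    · linarith

lemma mem_ball_strip {z w : Strip} {r : ℝ} :
    w ∈ Metric.ball z r ↔ |w.1 - z.1| < r ∧ |(w.2 : ℝ) - z.2| < r := by
  rw [Metric.mem_ball, Prod.dist_eq, max_lt_iff, Real.dist_eq, Subtype.dist_eq, Real.dist_eq]

lemma seg_mem_ball {z w : Strip} {r : ℝ} (h : w ∈ Metric.ball z r) {t : ℝ}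
    (ht : t ∈ Icc (0:ℝ) 1) : seg z w t ∈ Metric.ball z r := by
  rw [mem_ball_strip] at h ⊢
  rw [seg_fst, seg_snd _ _ ht.1 ht.2]
  have a1 : z.1 + t * (w.1 - z.1) - z.1 = t * (w.1 - z.1) := by ring
  have a2 : (z.2:ℝ) + t * (w.2 - z.2) - z.2 = t * (w.2 - z.2) := by ring
  rw [a1, a2, abs_mul, abs_mul, abs_of_nonneg ht.1]
  constructor
  · nlinarith [abs_nonneg (w.1 - z.1), ht.1, ht.2]
  · nlinarith [abs_nonneg ((w.2:ℝ) - z.2), ht.1, ht.2]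

lemma joinedIn_seg {S : Set Strip} {z w : Strip} (h : ∀ t ∈ Icc (0:ℝ) 1, seg z w t ∈ S) :
    JoinedIn S z w := by
  refine ⟨⟨⟨fun t => seg z w t, (continuous_seg z w).comp continuous_subtype_val⟩, ?_, ?_⟩, ?_⟩
  · simp [seg_zero]
  · simp [seg_one]
  · intro t; exact h t t.2

lemma ball_pathConn (z : Strip) {r : ℝ} (hr : 0 < r) : IsPathConnected (Metric.ball z r) :=
  ⟨z, Metric.mem_ball_self hr, fun _ hy => joinedIn_seg fun _ ht => seg_mem_ball hy ht⟩

instance : LocallyPathConnectedSpace Strip :=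
  .of_bases (fun _ => Metric.nhds_basis_ball) (fun x _ hr => ball_pathConn x hr)

/-- vertical segments -/
lemma joinedIn_vert {S : Set Strip} {x a b : ℝ} (ha : a ∈ II) (hb : b ∈ II) (hab : a ≤ b)
    (h : ∀ y ∈ Icc a b, pt x y ∈ S) : JoinedIn S (pt x a) (pt x b) := by
  apply joinedIn_seg
  intro t ht
  unfold seg
  rw [pt_fst, pt_fst, pt_snd _ ha.1 ha.2, pt_snd _ hb.1 hb.2]
  have := h (a + t * (b - a)) ⟨by nlinarith [ht.1], by nlinarith [ht.2]⟩
  simpa using this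


lemma isClosed_Xt {X Um Up : Set Ann} (hX : IsEAC X Um Up) : IsClosed (pr ⁻¹' X) :=
  hX.compact.isClosed.preimage continuous_pr

lemma II_neg_one : (-1 : ℝ) ∈ II := ⟨le_rfl, by norm_num⟩
lemma II_one : (1 : ℝ) ∈ II := ⟨by norm_num, le_rfl⟩

lemma pr_comp {X : Set Ann} {p : Ann} {S : Set Strip} (hS : IsPreconnected S)
    (hSX : S ⊆ pr ⁻¹' Xᶜ) {z : Strip} (hz : z ∈ S) (hzp : pr z ∈ connectedComponentIn Xᶜ p) :
    S ⊆ pr ⁻¹' (connectedComponentIn Xᶜ p) := by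
  rw [connectedComponentIn_eq hzp]
  rw [← image_subset_iff]
  exact (hS.image pr continuous_pr.continuousOn).subset_connectedComponentIn ⟨z, hz, rfl⟩
    (image_subset_iff.2 hSX)

lemma Xt_interior {X Um Up : Set Ann} (hX : IsEAC X Um Up) {z : Strip} (hz : z ∈ pr ⁻¹' X) :
    -1 < (z.2 : ℝ) ∧ (z.2 : ℝ) < 1 := hX.inInterior _ hz

lemma row_preconnected (y : ℝ) : IsPreconnected (range fun x : ℝ => pt x y) :=
  isPreconnected_range (continuous_pt continuous_id continuous_const)

lemma bot_not_X {X Um Up : Set Ann} (hX : IsEAC X Um Up) (x : ℝ) : pt x (-1) ∉ pr ⁻¹' X := by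
  intro h
  have := (Xt_interior hX h).1
  rw [pt_snd x le_rfl (by norm_num)] at this
  exact lt_irrefl _ this

lemma top_not_X {X Um Up : Set Ann} (hX : IsEAC X Um Up) (x : ℝ) : pt x 1 ∉ pr ⁻¹' X := by
  intro h
  have := (Xt_interior hX h).2
  rw [pt_snd x (by norm_num) le_rfl] at this
  exact lt_irrefl _ this

lemma pr_bot : pr (pt 0 (-1)) = ((0 : AddCircle (1 : ℝ)), ⟨-1, le_rfl, by norm_num⟩) := by
  unfold pr
  ext1
  · simp [pt_fst]
  · apply Subtype.ext; exact pt_snd 0 le_rfl (by norm_num)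

lemma pr_top : pr (pt 0 1) = ((0 : AddCircle (1 : ℝ)), ⟨1, by norm_num, le_rfl⟩) := by
  unfold pr
  ext1
  · simp [pt_fst]
  · apply Subtype.ext; exact pt_snd 0 (by norm_num) le_rfl

lemma bot_mem {X Um Up : Set Ann} (hX : IsEAC X Um Up) (x : ℝ) : pt x (-1) ∈ pr ⁻¹' Um := by
  rw [hX.hUm]
  refine pr_comp (row_preconnected (-1)) ?_ (z := pt 0 (-1)) ⟨0, rfl⟩ ?_ ⟨x, rfl⟩
  · rintro _ ⟨x, rfl⟩; exact bot_not_X hX x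
  · rw [pr_bot]
    apply mem_connectedComponentIn
    rw [← pr_bot]; exact bot_not_X hX 0

lemma top_mem {X Um Up : Set Ann} (hX : IsEAC X Um Up) (x : ℝ) : pt x 1 ∈ pr ⁻¹' Up := by
  rw [hX.hUp]
  refine pr_comp (row_preconnected 1) ?_ (z := pt 0 1) ⟨0, rfl⟩ ?_ ⟨x, rfl⟩
  · rintro _ ⟨x, rfl⟩; exact top_not_X hX x
  · rw [pr_top]
    apply mem_connectedComponentIn
    rw [← pr_top]; exact top_not_X hX 0

lemma Um_conn {X Um Up : Set Ann} (hX : IsEAC X Um Up) : IsPreconnected Um := by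
  rw [hX.hUm]; exact isPreconnected_connectedComponentIn
lemma Up_conn {X Um Up : Set Ann} (hX : IsEAC X Um Up) : IsPreconnected Up := by
  rw [hX.hUp]; exact isPreconnected_connectedComponentIn

lemma Um_Up_disj {X Um Up : Set Ann} (hX : IsEAC X Um Up) : Disjoint Um Up := by
  have := hX.ne
  rw [hX.hUm, hX.hUp] at this ⊢
  by_contra h
  rw [Set.not_disjoint_iff] at h
  obtain ⟨p, h1, h2⟩ := h
  exact this ((connectedComponentIn_eq h1).trans (connectedComponentIn_eq h2).symm)

/-- enlarge: a preconnected set off X touching Um lies in Um -/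
lemma sub_Um {X Um Up : Set Ann} (hX : IsEAC X Um Up) {S : Set Strip} (hS : IsPreconnected S)
    (hSX : ∀ z ∈ S, z ∉ pr ⁻¹' X) {z : Strip} (hz : z ∈ S) (hz' : z ∈ pr ⁻¹' Um) :
    S ⊆ pr ⁻¹' Um := by
  rw [hX.hUm] at hz' ⊢
  exact pr_comp hS hSX hz hz'

lemma sub_Up {X Um Up : Set Ann} (hX : IsEAC X Um Up) {S : Set Strip} (hS : IsPreconnected S)
    (hSX : ∀ z ∈ S, z ∉ pr ⁻¹' X) {z : Strip} (hz : z ∈ S) (hz' : z ∈ pr ⁻¹' Up) :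
    S ⊆ pr ⁻¹' Up := by
  rw [hX.hUp] at hz' ⊢
  exact pr_comp hS hSX hz hz'

lemma Um_notX {X Um Up : Set Ann} (hX : IsEAC X Um Up) {z : Strip} (hz : z ∈ pr ⁻¹' Um) :
    z ∉ pr ⁻¹' X := by
  have : pr z ∈ Xᶜ := by rw [hX.cover]; exact Or.inl hz
  exact this

lemma Up_notX {X Um Up : Set Ann} (hX : IsEAC X Um Up) {z : Strip} (hz : z ∈ pr ⁻¹' Up) :
    z ∉ pr ⁻¹' X := by
  have : pr z ∈ Xᶜ := by rw [hX.cover]; exact Or.inr hz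
  exact this

lemma Um_notUp {X Um Up : Set Ann} (hX : IsEAC X Um Up) {z : Strip} (hz : z ∈ pr ⁻¹' Um) :
    z ∉ pr ⁻¹' Up := fun h => (Set.disjoint_left.1 (Um_Up_disj hX)) hz h

lemma notX_cases {X Um Up : Set Ann} (hX : IsEAC X Um Up) {z : Strip} (hz : z ∉ pr ⁻¹' X) :
    z ∈ pr ⁻¹' Um ∨ z ∈ pr ⁻¹' Up := by
  have : pr z ∈ Xᶜ := hz
  rwa [hX.cover] at this

lemma ball_off {X Um Up : Set Ann} (hX : IsEAC X Um Up) {z : Strip} (hz : z ∉ pr ⁻¹' X) :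
    ∃ r > 0, Metric.ball z r ⊆ (pr ⁻¹' X)ᶜ :=
  Metric.isOpen_iff.1 (isClosed_Xt hX).isOpen_compl z hz

lemma isOpen_Ut {X Um Up : Set Ann} (hX : IsEAC X Um Up) : IsOpen (pr ⁻¹' Um) := by
  rw [Metric.isOpen_iff]
  intro z hz
  obtain ⟨r, hr, h⟩ := ball_off hX (Um_notX hX hz)
  exact ⟨r, hr, sub_Um hX (ball_pathConn z hr).isConnected.isPreconnected
    h (Metric.mem_ball_self hr) hz⟩

lemma isOpen_Upt {X Um Up : Set Ann} (hX : IsEAC X Um Up) : IsOpen (pr ⁻¹' Up) := by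
  rw [Metric.isOpen_iff]
  intro z hz
  obtain ⟨r, hr, h⟩ := ball_off hX (Up_notX hX hz)
  exact ⟨r, hr, sub_Up hX (ball_pathConn z hr).isConnected.isPreconnected
    h (Metric.mem_ball_self hr) hz⟩

lemma isOpen_Um {X Um Up : Set Ann} (hX : IsEAC X Um Up) : IsOpen Um := by
  have := isOpenMap_pr _ (isOpen_Ut hX)
  rwa [image_preimage_eq _ pr_surjective] at this

lemma isOpen_Up {X Um Up : Set Ann} (hX : IsEAC X Um Up) : IsOpen Up := by
  have := isOpenMap_pr _ (isOpen_Upt hX)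
  rwa [image_preimage_eq _ pr_surjective] at this

lemma vert_preconn (x a b : ℝ) : IsPreconnected ((fun y => pt x y) '' Icc a b) :=
  isPreconnected_Icc.image _ (continuous_pt continuous_const continuous_id).continuousOn

lemma vert_Um {X Um Up : Set Ann} (hX : IsEAC X Um Up) {x b : ℝ} (hb : -1 ≤ b)
    (h : ∀ y ∈ Icc (-1) b, pt x y ∉ pr ⁻¹' X) : ∀ y ∈ Icc (-1) b, pt x y ∈ pr ⁻¹' Um := by
  intro y hy
  refine sub_Um hX (vert_preconn x (-1) b) ?_ (z := pt x (-1)) ⟨-1, ⟨le_rfl, hb⟩, rfl⟩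
    (bot_mem hX x) ⟨y, hy, rfl⟩
  rintro _ ⟨y, hy, rfl⟩
  exact h y hy

lemma vert_Up {X Um Up : Set Ann} (hX : IsEAC X Um Up) {x b : ℝ} (hb : b ≤ 1)
    (h : ∀ y ∈ Icc b 1, pt x y ∉ pr ⁻¹' X) : ∀ y ∈ Icc b 1, pt x y ∈ pr ⁻¹' Up := by
  intro y hy
  refine sub_Up hX (vert_preconn x b 1) ?_ (z := pt x 1) ⟨1, ⟨hb, le_rfl⟩, rfl⟩
    (top_mem hX x) ⟨y, hy, rfl⟩
  rintro _ ⟨y, hy, rfl⟩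
  exact h y hy

lemma vert_meets {X Um Up : Set Ann} (hX : IsEAC X Um Up) (x : ℝ) :
    ∃ y ∈ Icc (-1 : ℝ) 1, pt x y ∈ pr ⁻¹' X := by
  by_contra h
  push Not at h
  have h1 := vert_Um hX (x := x) (b := 1) (by norm_num) h 1 ⟨by norm_num, le_rfl⟩
  exact Um_notUp hX h1 (top_mem hX x)

lemma vert_compact {X Um Up : Set Ann} (hX : IsEAC X Um Up) (x : ℝ) :
    IsCompact (Icc (-1 : ℝ) 1 ∩ (fun y => pt x y) ⁻¹' (pr ⁻¹' X)) :=
  isCompact_Icc.inter_right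
    ((isClosed_Xt hX).preimage (continuous_pt continuous_const continuous_id))

/-- lowest point -/
lemma exists_low {X Um Up : Set Ann} (hX : IsEAC X Um Up) (x : ℝ) :
    ∃ η, -1 < η ∧ η < 1 ∧ pt x η ∈ pr ⁻¹' X ∧
      ∀ y, -1 ≤ y → y < η → pt x y ∈ pr ⁻¹' Um := by
  obtain ⟨y, hy, hyX⟩ := vert_meets hX x
  obtain ⟨η, ⟨hη, hηX⟩, hmin⟩ := (vert_compact hX x).exists_isLeast ⟨y, hy, hyX⟩
  have hi := Xt_interior hX hηX
  rw [pt_snd x hη.1 hη.2] at hi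
  refine ⟨η, hi.1, hi.2, hηX, ?_⟩
  intro y h1 h2
  refine vert_Um hX h1 ?_ y ⟨h1, le_rfl⟩
  intro u hu hX'
  have := hmin ⟨⟨hu.1, by linarith [hu.2, hη.2]⟩, hX'⟩
  linarith [hu.2]

lemma exists_high {X Um Up : Set Ann} (hX : IsEAC X Um Up) (x : ℝ) :
    ∃ η, -1 < η ∧ η < 1 ∧ pt x η ∈ pr ⁻¹' X ∧
      ∀ y, y ≤ 1 → η < y → pt x y ∈ pr ⁻¹' Up := by
  obtain ⟨y, hy, hyX⟩ := vert_meets hX x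
  obtain ⟨η, ⟨hη, hηX⟩, hmax⟩ := (vert_compact hX x).exists_isGreatest ⟨y, hy, hyX⟩
  have hi := Xt_interior hX hηX
  rw [pt_snd x hη.1 hη.2] at hi
  refine ⟨η, hi.1, hi.2, hηX, ?_⟩
  intro y h1 h2
  refine vert_Up hX h1 ?_ y ⟨le_rfl, h1⟩
  intro u hu hX'
  have := hmax ⟨⟨by linarith [hu.1, hη.1], hu.2⟩, hX'⟩
  linarith [hu.1]

lemma joined_bot {X Um Up : Set Ann} (hX : IsEAC X Um Up) {z : Strip} (hz : z ∈ pr ⁻¹' Um) :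
    ∃ x, JoinedIn (pr ⁻¹' Um) z (pt x (-1)) := by
  set S : Set Strip := {z | ∃ x, JoinedIn (pr ⁻¹' Um) z (pt x (-1))} with hS
  have hloc : ∀ z ∈ pr ⁻¹' Um, ∃ r > 0, ∀ w ∈ Metric.ball z r, JoinedIn (pr ⁻¹' Um) z w := by
    intro z hz
    obtain ⟨r, hr, h⟩ := Metric.isOpen_iff.1 (isOpen_Ut hX) z hz
    exact ⟨r, hr, fun w hw => joinedIn_seg fun t ht => h (seg_mem_ball hw ht)⟩
  have hShift : ∀ k : ℤ, ∀ z ∈ S, shiftPt k z ∈ S := by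
    rintro k z ⟨x, hx⟩
    refine ⟨x + k, ?_⟩
    rw [← shiftPt_pt]
    refine (hx.map (continuous_shiftPt k)).mono ?_
    rintro _ ⟨w, hw, rfl⟩
    exact (mem_shift k).2 hw
  have hSU : S ⊆ pr ⁻¹' Um := fun z hz => hz.choose_spec.source_mem
  have hSo : IsOpen S := by
    rw [Metric.isOpen_iff]
    intro z hz
    obtain ⟨r, hr, h⟩ := hloc z (hSU hz)
    refine ⟨r, hr, fun w hw => ?_⟩
    obtain ⟨x, hx⟩ := hz
    exact ⟨x, (h w hw).symm.trans hx⟩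
  have hSc : IsOpen (pr ⁻¹' Um \ S) := by
    rw [Metric.isOpen_iff]
    rintro z ⟨hz, hzS⟩
    obtain ⟨r, hr, h⟩ := hloc z hz
    refine ⟨r, hr, fun w hw => ⟨(h w hw).target_mem, ?_⟩⟩
    rintro ⟨x, hx⟩
    exact hzS ⟨x, (h w hw).trans hx⟩
  have hdis : ∀ a, a ∈ pr '' S → a ∉ pr '' (pr ⁻¹' Um \ S) := by
    rintro _ ⟨z, hz, rfl⟩ ⟨w, hw, hwz⟩
    obtain ⟨k, rfl⟩ := pr_eq_iff.1 hwz.symm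
    exact hw.2 (hShift k z hz)
  have key := (isPreconnected_iff_subset_of_disjoint.1 (Um_conn hX)) (pr '' S)
    (pr '' (pr ⁻¹' Um \ S)) (isOpenMap_pr _ hSo) (isOpenMap_pr _ hSc) (by
      intro a ha
      obtain ⟨z, rfl⟩ := pr_surjective a
      by_cases hzS : z ∈ S
      · exact Or.inl ⟨z, hzS, rfl⟩
      · exact Or.inr ⟨z, ⟨ha, hzS⟩, rfl⟩) (by
      ext a; simp only [mem_inter_iff, mem_empty_iff_false, iff_false]
      rintro ⟨_, h1, h2⟩
      exact hdis a h1 h2)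
  have hb : pt 0 (-1) ∈ S := ⟨0, JoinedIn.refl (bot_mem hX 0)⟩
  rcases key with h | h
  · obtain ⟨w, hw, hwz⟩ := h hz
    obtain ⟨k, rfl⟩ := pr_eq_iff.1 hwz
    exact hShift k w hw
  · exact absurd (h (bot_mem hX 0)) (hdis _ ⟨_, hb, rfl⟩)

lemma joined_row {X Um Up : Set Ann} (hX : IsEAC X Um Up) (x x' : ℝ) :
    JoinedIn (pr ⁻¹' Um) (pt x (-1)) (pt x' (-1)) := by
  apply joinedIn_seg
  intro t ht
  have : seg (pt x (-1)) (pt x' (-1)) t = pt (x + t * (x' - x)) (-1) := by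
    unfold seg
    simp [pt_fst, pt_snd _ (le_refl (-1:ℝ)) (by norm_num)]
  rw [this]; exact bot_mem hX _

lemma pathConn_Ut {X Um Up : Set Ann} (hX : IsEAC X Um Up) : IsPathConnected (pr ⁻¹' Um) := by
  refine ⟨pt 0 (-1), bot_mem hX 0, fun {z} hz => ?_⟩
  obtain ⟨x, hx⟩ := joined_bot hX hz
  exact ((hx.trans (joined_row hX x 0))).symm

/-- difference vector as a complex number -/
noncomputable def dz (z w : Strip) : ℂ := ⟨z.1 - w.1, (z.2 : ℝ) - w.2⟩

/-- angular direction -/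
noncomputable def th (z w : Strip) : Real.Angle := (Complex.arg (dz z w) : Real.Angle)

lemma dz_ne {z w : Strip} (h : z ≠ w) : dz z w ≠ 0 := by
  intro e
  apply h
  have h1 := congrArg Complex.re e
  have h2 := congrArg Complex.im e
  simp [dz] at h1 h2
  exact strip_ext (by linarith) (by linarith)

lemma continuous_dz : Continuous (fun p : Strip × Strip => dz p.1 p.2) := by
  have h : (fun p : Strip × Strip => dz p.1 p.2) = fun p => Complex.equivRealProdCLM.symm
      (p.1.1 - p.2.1, (p.1.2 : ℝ) - p.2.2) := by
    ext p
    apply Complex.ext <;> simp [dz]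
  rw [h]
  apply (Complex.equivRealProdCLM.symm.continuous).comp
  exact ((continuous_fst.comp continuous_fst).sub (continuous_fst.comp continuous_snd)).prodMk
    ((continuous_h.comp continuous_fst).sub (continuous_h.comp continuous_snd))

lemma continuous_th {P : Type*} [TopologicalSpace P] {u v : P → Strip} (hu : Continuous u)
    (hv : Continuous v) (h : ∀ p, u p ≠ v p) : Continuous (fun p => th (u p) (v p)) := by
  rw [continuous_iff_continuousAt]
  intro p
  have h1 := Complex.continuousAt_arg_coe_angle (dz_ne (h p))
  have h2 : ContinuousAt (fun p => dz (u p) (v p)) p :=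
    (continuous_dz.comp (hu.prodMk hv)).continuousAt
  exact ContinuousAt.comp (f := fun p => dz (u p) (v p)) h1 h2

lemma cos_lift {z w : Strip} (h : z ≠ w) {a : ℝ} (ha : (a : Real.Angle) = th z w) :
    Real.cos a = (z.1 - w.1) / ‖dz z w‖ := by
  have := congrArg Real.Angle.cos ha
  unfold th at this
  rw [Real.Angle.cos_coe, Real.Angle.cos_coe, Complex.cos_arg (dz_ne h)] at this
  exact this

lemma sin_lift {z w : Strip} {a : ℝ} (ha : (a : Real.Angle) = th z w) :
    Real.sin a = ((z.2 : ℝ) - w.2) / ‖dz z w‖ := by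
  have := congrArg Real.Angle.sin ha
  unfold th at this
  rw [Real.Angle.sin_coe, Real.Angle.sin_coe, Complex.sin_arg] at this
  exact this

lemma cos_lift_pos {z w : Strip} (h : w.1 < z.1) {a : ℝ} (ha : (a : Real.Angle) = th z w) :
    0 < Real.cos a := by
  have hne : z ≠ w := by rintro rfl; exact lt_irrefl _ h
  rw [cos_lift hne ha]
  exact div_pos (by linarith) (norm_pos_iff.2 (dz_ne hne))

lemma cos_lift_neg {z w : Strip} (h : z.1 < w.1) {a : ℝ} (ha : (a : Real.Angle) = th z w) :
    Real.cos a < 0 := by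
  have hne : z ≠ w := by rintro rfl; exact lt_irrefl _ h
  rw [cos_lift hne ha]
  exact div_neg_of_neg_of_pos (by linarith) (norm_pos_iff.2 (dz_ne hne))

lemma sin_lift_neg {z w : Strip} (h : (z.2 : ℝ) < w.2) {a : ℝ} (ha : (a : Real.Angle) = th z w) :
    Real.sin a < 0 := by
  have hne : z ≠ w := by rintro rfl; exact lt_irrefl _ h
  rw [sin_lift ha]
  exact div_neg_of_neg_of_pos (by linarith) (norm_pos_iff.2 (dz_ne hne))

lemma angle_eq_of_lt {a b : ℝ} (h : (a : Real.Angle) = b) (hab : |a - b| < 2 * Real.pi) :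
    a = b := by
  rw [Real.Angle.angle_eq_iff_two_pi_dvd_sub] at h
  obtain ⟨k, hk⟩ := h
  rw [hk, abs_mul, abs_of_pos Real.two_pi_pos] at hab
  have : |(k : ℝ)| < 1 := by
    by_contra hc
    push Not at hc
    nlinarith [Real.two_pi_pos]
  have h0 : k = 0 := by
    rw [← Int.cast_abs] at this
    exact Int.abs_lt_one_iff.1 (by exact_mod_cast this)
  rw [h0] at hk
  simp at hk
  linarith

/-- two lifts on a preconnected set differ by a constant -/
lemma lifts_const {P : Type*} [TopologicalSpace P] {S : Set P} (hS : IsPreconnected S)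
    {A B : P → ℝ} (hA : ContinuousOn A S) (hB : ContinuousOn B S)
    (h : ∀ p ∈ S, (A p : Real.Angle) = B p) {p q : P} (hp : p ∈ S) (hq : q ∈ S) :
    A p - B p = A q - B q := by
  have hc : ContinuousOn (fun p => (A p - B p) / (2 * Real.pi)) S := (hA.sub hB).div_const _
  have hInt0 : ∀ p ∈ S, ∃ k : ℤ, (A p - B p) / (2 * Real.pi) = k := by
    intro p hp
    obtain ⟨k, hk⟩ := Real.Angle.angle_eq_iff_two_pi_dvd_sub.1 (h p hp)
    exact ⟨k, by rw [hk]; field_simp⟩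
  have hpre := hS.image _ hc
  have main : ∀ p ∈ S, ∀ q ∈ S, (A p - B p) / (2 * Real.pi) ≤ (A q - B q) / (2 * Real.pi) := by
    intro p hp q hq
    by_contra hlt
    push Not at hlt
    obtain ⟨k, hk⟩ := hInt0 p hp
    obtain ⟨l, hl⟩ := hInt0 q hq
    have hlk : l < k := by rw [hk, hl] at hlt; exact_mod_cast hlt
    have hlk' : (l : ℝ) + 1 ≤ k := by exact_mod_cast hlk
    have := hpre.Icc_subset ⟨q, hq, rfl⟩ ⟨p, hp, rfl⟩
    obtain ⟨r, hr, hre⟩ := this (a := (l : ℝ) + 1 / 2) ⟨by simp only [hl]; linarith,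
      by simp only [hk]; linarith⟩
    obtain ⟨m, hm⟩ := hInt0 r hr
    simp only [hm] at hre
    have h1 : (l : ℝ) < m := by rw [hre]; linarith
    have h2 : (m : ℝ) < l + 1 := by rw [hre]; linarith
    have h1' : l < m := by exact_mod_cast h1
    have h2' : m < l + 1 := by exact_mod_cast h2
    omega
  have := le_antisymm (main p hp q hq) (main q hq p hp)
  have hpi := Real.two_pi_pos
  field_simp at this
  linarith

lemma cos_conn {P : Type*} [TopologicalSpace P] {S : Set P} (hS : IsPreconnected S)
    {g : P → ℝ} (hg : ContinuousOn g S) (h : ∀ p ∈ S, 0 < Real.cos (g p)) {p q : P} (hp : p ∈ S)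
    (hq : q ∈ S) (h0 : g p ∈ Ioo (-(Real.pi / 2)) (Real.pi / 2)) :
    g q ∈ Ioo (-(Real.pi / 2)) (Real.pi / 2) := by
  have hpre := hS.image _ hg
  by_contra hc
  rw [mem_Ioo, not_and_or, not_lt, not_lt] at hc
  rcases hc with hc | hc
  · obtain ⟨r, hr, hre⟩ := hpre.Icc_subset ⟨q, hq, rfl⟩ ⟨p, hp, rfl⟩ ⟨hc, h0.1.le⟩
    have := h r hr
    rw [hre, Real.cos_neg, Real.cos_pi_div_two] at this
    exact lt_irrefl _ this
  · obtain ⟨r, hr, hre⟩ := hpre.Icc_subset ⟨p, hp, rfl⟩ ⟨q, hq, rfl⟩ ⟨h0.2.le, hc⟩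
    have := h r hr
    rw [hre, Real.cos_pi_div_two] at this
    exact lt_irrefl _ this

lemma cos_conn_neg {P : Type*} [TopologicalSpace P] {S : Set P} (hS : IsPreconnected S)
    {g : P → ℝ} (hg : ContinuousOn g S) (h : ∀ p ∈ S, Real.cos (g p) < 0) {p q : P} (hp : p ∈ S)
    (hq : q ∈ S) (h0 : g p ∈ Ioo (-(3 * Real.pi / 2)) (-(Real.pi / 2))) :
    g q ∈ Ioo (-(3 * Real.pi / 2)) (-(Real.pi / 2)) := by
  have := cos_conn hS (g := fun p => g p + Real.pi) (hg.add continuousOn_const) (fun p hp => by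
    rw [Real.cos_add_pi]; linarith [h p hp]) hp hq ⟨by linarith [h0.1], by linarith [h0.2]⟩
  exact ⟨by linarith [this.1], by linarith [this.2]⟩

lemma isCov : IsCoveringMap (fun x : ℝ => (x : Real.Angle)) :=
  AddCircle.isCoveringMap_coe (2 * Real.pi)

lemma lift_htpy {P : Type*} [TopologicalSpace P] (G : unitInterval × P → Real.Angle)
    (hG : Continuous G) (g0 : P → ℝ) (hg0 : Continuous g0)
    (h0 : ∀ p, (g0 p : Real.Angle) = G (0, p)) :
    ∃ L : unitInterval × P → ℝ, Continuous L ∧ (∀ q, (L q : Real.Angle) = G q) ∧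
      ∀ p, L (0, p) = g0 p := by
  refine ⟨isCov.liftHomotopy ⟨G, hG⟩ ⟨g0, hg0⟩ (fun p => (h0 p).symm),
    ContinuousMap.continuous _, ?_, ?_⟩
  · intro q
    exact congrFun (isCov.liftHomotopy_lifts ⟨G, hG⟩ ⟨g0, hg0⟩ (fun p => (h0 p).symm)) q
  · intro p
    exact isCov.liftHomotopy_zero ⟨G, hG⟩ ⟨g0, hg0⟩ (fun p => (h0 p).symm) p

/-- branch of the argument with the cut pointing downwards -/
noncomputable def br (d : ℂ) : ℝ := Complex.arg (-Complex.I * d) + Real.pi / 2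

lemma br_coe {d : ℂ} (hd : d ≠ 0) : (br d : Real.Angle) = (Complex.arg d : Real.Angle) := by
  unfold br
  rw [Real.Angle.coe_add, Complex.arg_mul_coe_angle (by simp) hd, Complex.arg_neg_I,
    add_right_comm, ← Real.Angle.coe_add]
  simp

lemma br_gt (d : ℂ) : -(Real.pi / 2) < br d := by
  unfold br; linarith [Complex.neg_pi_lt_arg (-Complex.I * d)]

lemma br_slit {d : ℂ} (h : d.re ≠ 0 ∨ 0 < d.im) : -Complex.I * d ∈ Complex.slitPlane := by
  rw [Complex.mem_slitPlane_iff]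
  simp
  tauto

lemma br_lt {d : ℂ} (h : d.re ≠ 0 ∨ 0 < d.im) : br d < 3 * Real.pi / 2 := by
  have := Complex.arg_lt_pi_iff.2 (by
    have := br_slit h
    rw [Complex.mem_slitPlane_iff] at this
    rcases this with h | h
    · exact Or.inl h.le
    · exact Or.inr h)
  unfold br; linarith

lemma br_cont {d : ℂ} (h : d.re ≠ 0 ∨ 0 < d.im) : ContinuousAt br d := by
  have h1 := Complex.continuousAt_arg (br_slit h)
  have h2 : ContinuousAt (fun d : ℂ => -Complex.I * d) d := by fun_prop
  exact (ContinuousAt.comp (f := fun d : ℂ => -Complex.I * d) h1 h2).add continuousAt_const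

lemma sin_conn {P : Type*} [TopologicalSpace P] {S : Set P} (hS : IsPreconnected S)
    {g : P → ℝ} (hg : ContinuousOn g S) (h : ∀ p ∈ S, Real.sin (g p) < 0) {p q : P} (hp : p ∈ S)
    (hq : q ∈ S) (h0 : g p ∈ Ioo (-Real.pi) 0) : g q ∈ Ioo (-Real.pi) 0 := by
  have := cos_conn hS (g := fun p => g p + Real.pi / 2) (hg.add continuousOn_const) (fun p hp => by
    rw [Real.cos_add_pi_div_two]; linarith [h p hp]) hp hq ⟨by linarith [h0.1], by linarith [h0.2]⟩
  exact ⟨by linarith [this.1], by linarith [this.2]⟩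

lemma arg_mem_of_im_neg {d : ℂ} (h : d.im < 0) : Complex.arg d ∈ Ioo (-Real.pi) 0 :=
  ⟨Complex.neg_pi_lt_arg d, Complex.arg_neg_iff.2 h⟩

lemma lift_low {Y : Set Strip} {γ : unitInterval → Strip} (hγ : Continuous γ)
    (h0 : ((γ 0).2 : ℝ) = -1) (hY : ∀ w ∈ Y, -1 < (w.2 : ℝ)) (hYγ : ∀ w ∈ Y, w ∉ range γ) :
    ∃ L : unitInterval × Y → ℝ, Continuous L ∧ (∀ t w, (L (t, w) : Real.Angle) = th (γ t) w) ∧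
      ∀ w : Y, L (0, w) = Complex.arg (dz (γ 0) w) := by
  obtain ⟨L, hL, h1, h2⟩ := lift_htpy (P := Y) (fun q => th (γ q.1) q.2)
    (continuous_th (hγ.comp continuous_fst) (continuous_subtype_val.comp continuous_snd)
      (fun p e => hYγ _ p.2.2 ⟨p.1, e⟩)) (fun w => Complex.arg (dz (γ 0) w)) (by
      rw [continuous_iff_continuousAt]
      intro w
      have hc : ContinuousAt (fun w : Y => dz (γ 0) w) w :=
        (continuous_dz.comp (continuous_const.prodMk continuous_subtype_val)).continuousAt
      refine ContinuousAt.comp (f := fun w : Y => dz (γ 0) w) (Complex.continuousAt_arg ?_) hc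
      rw [Complex.mem_slitPlane_iff]
      right
      have := hY _ w.2
      simp only [dz, h0]
      linarith) (fun p => rfl)
  exact ⟨L, hL, fun t w => h1 (t, w), h2⟩

lemma wind {X Um Up : Set Ann} (hX : IsEAC X Um Up) {γ γ' : unitInterval → Strip}
    (hγ : Continuous γ) (hγ' : Continuous γ') (hU : ∀ t, γ t ∈ pr ⁻¹' Um)
    (hU' : ∀ t, γ' t ∈ pr ⁻¹' Um) (h0 : γ 0 = pt 0 (-1)) (h0' : γ' 0 = pt 0 (-1))
    (h1 : γ 1 = γ' 1) {Q : Strip} (hQ : Q ∈ pr ⁻¹' X) {Γ Γ' : unitInterval → ℝ}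
    (hΓ : Continuous Γ) (hΓ' : Continuous Γ') (hl : ∀ t, (Γ t : Real.Angle) = th (γ t) Q)
    (hl' : ∀ t, (Γ' t : Real.Angle) = th (γ' t) Q)
    (hs : Γ 0 = Complex.arg (dz (pt 0 (-1)) Q)) (hs' : Γ' 0 = Complex.arg (dz (pt 0 (-1)) Q)) :
    Γ 1 = Γ' 1 := by
  by_contra hne
  set Y : Set Strip := {w | -1 < (w.2 : ℝ)} ∩ ((range γ)ᶜ ∩ (range γ')ᶜ) with hYdef
  have hYo : IsOpen Y := (isOpen_lt continuous_const continuous_h).inter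
    ((isCompact_range hγ).isClosed.isOpen_compl.inter
      (isCompact_range hγ').isClosed.isOpen_compl)
  have b0 : ((γ 0).2 : ℝ) = -1 := by rw [h0]; exact pt_snd 0 le_rfl (by norm_num)
  have b0' : ((γ' 0).2 : ℝ) = -1 := by rw [h0']; exact pt_snd 0 le_rfl (by norm_num)
  obtain ⟨L, hL, hLl, hL0⟩ := lift_low (Y := Y) hγ b0 (fun w hw => hw.1) (fun w hw => hw.2.1)
  obtain ⟨L', hL', hLl', hL0'⟩ :=
    lift_low (Y := Y) hγ' b0' (fun w hw => hw.1) (fun w hw => hw.2.2)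
  have hXY : pr ⁻¹' X ⊆ Y := by
    intro w hw
    refine ⟨(Xt_interior hX hw).1, ?_, ?_⟩
    · rintro ⟨t, rfl⟩; exact Um_notX hX (hU t) hw
    · rintro ⟨t, rfl⟩; exact Um_notX hX (hU' t) hw
  have hUpY : ∀ w ∈ pr ⁻¹' Up, w ∈ Y := by
    intro w hw
    refine ⟨?_, ?_, ?_⟩
    · rcases (snd_ge w).lt_or_eq with h | h
      · exact h
      · exfalso
        have := bot_mem hX w.1
        rw [h, pt_self] at this
        exact Um_notUp hX this hw
    · rintro ⟨t, rfl⟩; exact Um_notUp hX (hU t) hw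
    · rintro ⟨t, rfl⟩; exact Um_notUp hX (hU' t) hw
  set D : Y → ℝ := fun w => L (1, w) - L' (1, w) with hD
  have hc1 : Continuous fun w : Y => L (1, w) := hL.comp (continuous_const.prodMk continuous_id)
  have hc1' : Continuous fun w : Y => L' (1, w) := hL'.comp (continuous_const.prodMk continuous_id)
  have hDc : Continuous D := hc1.sub hc1'
  have hang : ∀ w : Y, (L (1, w) : Real.Angle) = L' (1, w) := by
    intro w; rw [hLl, hLl', h1]
  have hDQ : D ⟨Q, hXY hQ⟩ ≠ 0 := by
    have e1 := lifts_const (S := (univ : Set unitInterval)) isPreconnected_univ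
      (A := fun t => L (t, ⟨Q, hXY hQ⟩)) (B := Γ)
      (hL.comp (continuous_id.prodMk continuous_const)).continuousOn hΓ.continuousOn
      (fun t _ => by rw [hLl, hl]) (mem_univ 0) (mem_univ 1)
    have e2 := lifts_const (S := (univ : Set unitInterval)) isPreconnected_univ
      (A := fun t => L' (t, ⟨Q, hXY hQ⟩)) (B := Γ')
      (hL'.comp (continuous_id.prodMk continuous_const)).continuousOn hΓ'.continuousOn
      (fun t _ => by rw [hLl', hl']) (mem_univ 0) (mem_univ 1)
    simp only [hL0, hL0', h0, h0', hs, hs'] at e1 e2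
    intro h
    apply hne
    simp only [hD] at h
    linarith
  have hnotop : ∀ z ∈ pr ⁻¹' Um, (z.2 : ℝ) < 1 := by
    intro z hz
    rcases (snd_le z).lt_or_eq with h | h
    · exact h
    · have := top_mem hX z.1
      rw [← h, pt_self] at this
      exact absurd this (Um_notUp hX hz)
  have htop : ∀ w : Y, ((w : Strip).2 : ℝ) = 1 → D w = 0 := by
    intro w hw
    have a1 : L (1, w) ∈ Ioo (-Real.pi) 0 := by
      refine sin_conn (S := (univ : Set unitInterval)) isPreconnected_univ
        (g := fun t => L (t, w)) (hL.comp (continuous_id.prodMk continuous_const)).continuousOn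
        (fun t _ => sin_lift_neg (by rw [hw]; exact hnotop _ (hU t)) (hLl t w)) (mem_univ 0)
        (mem_univ 1) ?_
      simp only [hL0]
      apply arg_mem_of_im_neg
      simp only [dz, b0, hw]; norm_num
    have a2 : L' (1, w) ∈ Ioo (-Real.pi) 0 := by
      refine sin_conn (S := (univ : Set unitInterval)) isPreconnected_univ
        (g := fun t => L' (t, w)) (hL'.comp (continuous_id.prodMk continuous_const)).continuousOn
        (fun t _ => sin_lift_neg (by rw [hw]; exact hnotop _ (hU' t)) (hLl' t w)) (mem_univ 0)
        (mem_univ 1) ?_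
      simp only [hL0']
      apply arg_mem_of_im_neg
      simp only [dz, b0', hw]; norm_num
    have := angle_eq_of_lt (hang w) (by rw [abs_lt]; constructor <;> linarith [a1.1, a1.2, a2.1, a2.2])
    simp only [hD]; linarith
  have hvert : ∀ w : Y, (∀ y, y ≤ 1 → ((w : Strip).2 : ℝ) ≤ y → pt (w : Strip).1 y ∈ Y) →
      D w = 0 := by
    intro w hw
    have hy : ∀ y : Icc ((w : Strip).2 : ℝ) 1, pt (w : Strip).1 y ∈ Y := fun y =>
      hw y y.2.2 y.2.1
    have hle := snd_le (w : Strip)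
    let v : Icc ((w : Strip).2 : ℝ) 1 → Y := fun y => ⟨pt (w : Strip).1 y, hy y⟩
    have hv : Continuous v :=
      (continuous_pt continuous_const continuous_subtype_val).subtype_mk _
    have hpre : IsPreconnected (univ : Set (Icc ((w : Strip).2 : ℝ) 1)) :=
      (isPreconnected_iff_preconnectedSpace.1 isPreconnected_Icc).isPreconnected_univ
    have := lifts_const hpre (A := fun y => L (1, v y)) (B := fun y => L' (1, v y))
      (hc1.comp hv).continuousOn (hc1'.comp hv).continuousOn (fun y _ => hang (v y))
      (mem_univ ⟨_, le_rfl, hle⟩) (mem_univ ⟨1, hle, le_rfl⟩)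
    have e1 : v ⟨_, le_rfl, hle⟩ = w := Subtype.ext (pt_self _)
    have e2 : D (v ⟨1, hle, le_rfl⟩) = 0 := htop _ (pt_snd _ (by norm_num) le_rfl)
    simp only [hD] at e2 ⊢
    rw [e1] at this
    linarith
  set N : Set Strip := Subtype.val '' {w : Y | D w ≠ 0} with hN
  have hNo : IsOpen N := hYo.isOpenMap_subtype_val _ (isOpen_ne_fun hDc continuous_const)
  have hZo : IsOpen (Subtype.val '' {w : Y | |D w| < 2 * Real.pi}) :=
    hYo.isOpenMap_subtype_val _ (isOpen_lt hDc.abs continuous_const)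
  have hNX : N ∩ pr ⁻¹' X = pr ⁻¹' X \ (Subtype.val '' {w : Y | |D w| < 2 * Real.pi}) := by
    ext w
    constructor
    · rintro ⟨⟨u, hu, rfl⟩, hw⟩
      refine ⟨hw, ?_⟩
      rintro ⟨u', hu', e⟩
      rw [Subtype.ext e] at hu'
      have := angle_eq_of_lt (hang u) hu'
      exact hu (sub_eq_zero.2 this)
    · rintro ⟨hw, h⟩
      refine ⟨⟨⟨w, hXY hw⟩, ?_, rfl⟩, hw⟩
      intro e
      refine h ⟨⟨w, hXY hw⟩, ?_, rfl⟩
      rw [mem_ofPred_eq, e, abs_zero]; exact Real.two_pi_pos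
  have hcl : IsClosed (N ∩ pr ⁻¹' X) := by
    rw [hNX]; exact (isClosed_Xt hX).sdiff hZo
  obtain ⟨R, hR⟩ : ∃ R, ∀ z ∈ range γ ∪ range γ', |z.1| ≤ R := by
    have := ((isCompact_range hγ).union (isCompact_range hγ')).exists_bound_of_continuousOn
      (f := fun z : Strip => z.1) continuous_fst.continuousOn
    simpa using this
  have hcomp : IsCompact (N ∩ pr ⁻¹' X) := by
    refine (isCompact_Icc (a := -R) (b := R)).prod (isCompact_univ (X := II)) |>.of_isClosed_subset
      hcl ?_
    rintro _ ⟨⟨u, hu, rfl⟩, hw⟩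
    refine ⟨abs_le.1 ?_, mem_univ _⟩
    by_contra hlt
    apply hu
    apply hvert
    intro y hy1 hy2
    refine ⟨?_, ?_, ?_⟩
    · show -1 < ((pt _ y).2 : ℝ)
      rw [pt_snd _ (by linarith [snd_ge (u : Strip)]) hy1]
      linarith [u.2.1.out]
    · intro hr; exact hlt (hR (pt (u : Strip).1 y) (Or.inl hr))
    · intro hr; exact hlt (hR (pt (u : Strip).1 y) (Or.inr hr))
  have key := (isPreconnected_iff_subset_of_disjoint.1 hX.connected.isPreconnected) (pr '' N)
    (pr '' (N ∩ pr ⁻¹' X))ᶜ (isOpenMap_pr _ hNo)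
    (hcomp.image continuous_pr).isClosed.isOpen_compl (by
      intro a ha
      by_cases h : a ∈ pr '' (N ∩ pr ⁻¹' X)
      · exact Or.inl (image_mono inter_subset_left h)
      · exact Or.inr h) (by
      ext a; simp only [mem_inter_iff, mem_empty_iff_false, iff_false]
      rintro ⟨ha, ⟨w, hw, rfl⟩, h2⟩
      exact h2 ⟨w, ⟨hw, ha⟩, rfl⟩)
  rcases key with h | h
  · obtain ⟨η, hη1, hη2, hηX, hηU⟩ := exists_high hX 0
    obtain ⟨w, ⟨u, hu, rfl⟩, hw⟩ := h hηX
    obtain ⟨k, hk⟩ := pr_eq_iff.1 hw.symm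
    apply hu
    apply hvert
    intro y hy1 hy2
    rw [hk, shiftPt_pt, pt_fst] at *
    rw [pt_snd _ hη1.le hη2.le] at hy2
    rw [← shiftPt_pt]
    rcases hy2.lt_or_eq with h | h
    · exact hUpY _ ((mem_shift k).2 (hηU y hy1 h))
    · rw [← h]; exact hXY ((mem_shift k).2 hηX)
  · exact h hQ ⟨Q, ⟨⟨⟨Q, hXY hQ⟩, hDQ, rfl⟩, hQ⟩, rfl⟩

lemma exists_A {X Um Up : Set Ann} (hX : IsEAC X Um Up) {Q : Strip} (hQ : Q ∈ pr ⁻¹' X) :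
    ∃ A : Strip → ℝ, ContinuousOn A (pr ⁻¹' Um) ∧
      (∀ z ∈ pr ⁻¹' Um, (A z : Real.Angle) = th z Q) ∧
      ∀ x, A (pt x (-1)) ∈ Ioo (-Real.pi) 0 := by
  set U : Set Strip := pr ⁻¹' Um with hU
  have : PathConnectedSpace U := isPathConnected_iff_pathConnectedSpace.1 (pathConn_Ut hX)
  have : LocallyPathConnectedSpace U := (isOpen_Ut hX).locallyPathConnectedSpace
  have hne : ∀ z : U, (z : Strip) ≠ Q := by
    intro z e; exact Um_notX hX z.2 (by rw [e]; exact hQ)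
  let g : C(U, Real.Angle) := ⟨fun z => th z Q,
    continuous_th continuous_subtype_val continuous_const hne⟩
  have hQ1 := (Xt_interior hX hQ).1
  obtain ⟨A, ⟨hA0, hA⟩, -⟩ := isCov.isLocalHomeomorph.existsUnique_continuousMap_lifts g
    ⟨pt 0 (-1), bot_mem hX 0⟩ (Complex.arg (dz (pt 0 (-1)) Q)) rfl (fun γ hγ => by
      simpa [and_comm] using isCov.exists_path_lifts (g.comp γ) (Complex.arg (dz (pt 0 (-1)) Q))
        (by simp [hγ, g, th]))
    (by
      intro γ γ' Γ Γ' a1 a2 a3 a4 a5 a6 a7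
      exact wind hX (γ := fun t => γ t) (γ' := fun t => γ' t)
        (continuous_subtype_val.comp γ.continuous) (continuous_subtype_val.comp γ'.continuous)
        (fun t => (γ t).2) (fun t => (γ' t).2) (by rw [a1]) (by rw [a2]) (by rw [a7]) hQ
        Γ.continuous Γ'.continuous (fun t => congrFun a5 t) (fun t => congrFun a6 t) a3 a4)
  have hA' : ∀ z : U, (A z : Real.Angle) = th z Q := fun z => congrFun hA z
  classical
  refine ⟨fun z => if h : z ∈ U then A ⟨z, h⟩ else 0, ?_, ?_, ?_⟩
  · rw [continuousOn_iff_continuous_domRestrict]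
    convert A.continuous using 1
    ext z; simp [z.2]
  · intro z hz
    simp only [hz, dite_true]
    exact hA' ⟨z, hz⟩
  · intro x
    simp only [show pt x (-1) ∈ U from bot_mem hX x, dite_true]
    have hv : Continuous (fun x : ℝ => (⟨pt x (-1), bot_mem hX x⟩ : U)) :=
      (continuous_pt continuous_id continuous_const).subtype_mk _
    refine sin_conn (S := (univ : Set ℝ)) isPreconnected_univ
      (g := fun x => A ⟨pt x (-1), bot_mem hX x⟩) (A.continuous.comp hv).continuousOn
      (fun x _ => sin_lift_neg (z := pt x (-1)) ?_ (hA' ⟨pt x (-1), bot_mem hX x⟩)) (mem_univ 0)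
        (mem_univ x) ?_
    · rw [pt_snd _ le_rfl (by norm_num)]; exact hQ1
    · rw [hA0]
      apply arg_mem_of_im_neg
      simp only [dz]
      rw [pt_snd _ le_rfl (by norm_num)]; linarith

lemma isCov1 : IsCoveringMap (fun x : ℝ => (x : AddCircle (1:ℝ))) :=
  AddCircle.isCoveringMap_coe (1 : ℝ)

lemma coe_add_int (x : ℝ) (k : ℤ) : ((x + k : ℝ) : AddCircle (1:ℝ)) = x := by
  have h2 : ((k : ℝ) : AddCircle (1:ℝ)) = 0 := by
    rw [AddCircle.coe_eq_zero_iff]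
    exact ⟨k, by simp⟩
  rw [AddCircle.coe_add, h2, add_zero]

instance : ConnectedSpace II := isConnected_iff_connectedSpace.1 (isConnected_Icc (by norm_num))

lemma iso_lift {f : Ann → Ann} (hf : IsotopicToId f) {F : Strip → Strip} (hFc : Continuous F)
    (hF : IsLift f F) :
    ∃ (M : ℝ) (h : unitInterval → Strip → Strip) (c : ℤ),
      Continuous (fun q : unitInterval × Strip => h q.1 q.2) ∧ (∀ z, h 0 z = z) ∧
      (∀ t, Injective (h t)) ∧ (∀ t z, |(h t z).1 - z.1| ≤ M) ∧ ∀ z, h 1 z = shiftPt c (F z) := by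
  obtain ⟨H, hH, hbij, H0, H1⟩ := hf
  have hHc : Continuous fun q : unitInterval × Strip => H q.1 (pr q.2) :=
    hH.comp ((continuous_subtype_val.comp continuous_fst).prodMk
      (continuous_pr.comp continuous_snd))
  let G : C(unitInterval × Strip, AddCircle (1:ℝ)) :=
    ⟨fun q => (H q.1 (pr q.2)).1, continuous_fst.comp hHc⟩
  have hG0 : ∀ z : Strip, G (0, z) = ((z.1 : ℝ) : AddCircle (1:ℝ)) := by
    intro z
    show (H ((0 : unitInterval) : ℝ) (pr z)).1 = _
    rw [Set.Icc.coe_zero, H0]; rfl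
  obtain ⟨L, hL, hLl, hL0⟩ : ∃ L : unitInterval × Strip → ℝ, Continuous L ∧
      (∀ q, ((L q : ℝ) : AddCircle (1:ℝ)) = (H q.1 (pr q.2)).1) ∧ ∀ z, L (0, z) = z.1 :=
    ⟨isCov1.liftHomotopy G ⟨fun z => z.1, continuous_fst⟩ hG0, ContinuousMap.continuous _,
      fun q => congrFun (isCov1.liftHomotopy_lifts G ⟨fun z => z.1, continuous_fst⟩ hG0) q,
      fun z => isCov1.liftHomotopy_zero G ⟨fun z => z.1, continuous_fst⟩ hG0 z⟩
  have hshift : ∀ (k : ℤ) t z, L (t, shiftPt k z) = L (t, z) + k := by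
    intro k t z
    have := isCov1.eq_of_comp_eq (A := unitInterval) (g₁ := fun t => L (t, shiftPt k z))
      (g₂ := fun t => L (t, z) + k) (hL.comp (continuous_id.prodMk continuous_const))
      ((hL.comp (continuous_id.prodMk continuous_const)).add continuous_const) (by
        ext t
        simp only [comp_apply]
        rw [coe_add_int, hLl, hLl, pr_shiftPt]) 0 (by simp [hL0, shiftPt])
    exact congrFun this t
  have hpr : ∀ t z, pr (L (t, z), (H t (pr z)).2) = H t (pr z) := by
    intro t z
    unfold pr
    ext1
    · exact hLl (t, z)
    · rfl
  obtain ⟨M, hM⟩ : ∃ M, ∀ q ∈ (univ : Set unitInterval) ×ˢ ((Icc (0:ℝ) 1) ×ˢ (univ : Set II)),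
      ‖L q - q.2.1‖ ≤ M := by
    refine IsCompact.exists_bound_of_continuousOn
      (isCompact_univ.prod (isCompact_Icc.prod isCompact_univ)) ?_
    exact (hL.sub (continuous_fst.comp continuous_snd)).continuousOn
  have hfr : ∀ z : Strip, ((L (1, z) : ℝ) : AddCircle (1:ℝ)) = ((F z).1 : ℝ) := by
    intro z
    have h1 := hLl (1, z)
    simp only [Set.Icc.coe_one, H1] at h1
    rw [h1, ← hF.1]; rfl
  obtain ⟨c, hc⟩ : ∃ c : ℤ, L (1, pt 0 0) = (F (pt 0 0)).1 + c := by
    have h1 := hfr (pt 0 0)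
    rw [← sub_eq_zero, ← AddCircle.coe_sub, AddCircle.coe_eq_zero_iff] at h1
    obtain ⟨k, hk⟩ := h1
    refine ⟨k, ?_⟩
    simp at hk
    linarith
  refine ⟨M, fun t z => (L (t, z), (H t (pr z)).2), c, ?_, ?_, ?_, ?_, ?_⟩
  · exact hL.prodMk (continuous_snd.comp hHc)
  · intro z
    ext1
    · exact hL0 z
    · show (H ((0 : unitInterval) : ℝ) (pr z)).2 = _
      rw [Set.Icc.coe_zero, H0]; rfl
  · intro t z w e
    have e' : H t (pr z) = H t (pr w) := by
      rw [← hpr t z, ← hpr t w]; exact congrArg pr e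
    obtain ⟨k, rfl⟩ := pr_eq_iff.1 ((hbij t).1 e')
    have e1 : L (t, z) = L (t, shiftPt k z) := congrArg (fun a : Strip => a.1) e
    rw [hshift] at e1
    have : (k : ℝ) = 0 := by linarith
    have : k = 0 := by exact_mod_cast this
    rw [this, shiftPt_zero]
  · intro t z
    have := hM (t, shiftPt (-⌊z.1⌋) z) ⟨mem_univ _, ?_, mem_univ _⟩
    · rw [hshift] at this
      simp only [shiftPt, Real.norm_eq_abs] at this
      convert this using 2
      ring
    · simp only [shiftPt]
      push_cast
      exact ⟨by linarith [Int.floor_le z.1], by linarith [(Int.lt_floor_add_one z.1).le]⟩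
  · intro z
    have := isCov1.eq_of_comp_eq (A := Strip) (g₁ := fun z => L (1, z))
      (g₂ := fun z => (F z).1 + c) (hL.comp (continuous_const.prodMk continuous_id))
      ((continuous_fst.comp hFc).add continuous_const) (by
        ext z
        simp only [comp_apply]
        rw [coe_add_int, hfr]) (pt 0 0) hc
    ext1
    · exact congrFun this z
    · show (H ((1 : unitInterval) : ℝ) (pr z)).2 = (F z).2
      rw [Set.Icc.coe_one, H1, ← hF.1]; rfl

lemma th_shift (c : ℤ) (z w : Strip) : th (shiftPt c z) (shiftPt c w) = th z w := by
  unfold th dz shiftPt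
  simp

/-- the transport property with constant `M` -/
def Transp (F : Strip → Strip) (M : ℝ) : Prop :=
  ∀ (P : Type) [TopologicalSpace P] (p : P → Strip) (q : Strip) (a0 : P → ℝ),
    Continuous p → (∀ a, p a ≠ q) → Continuous a0 → (∀ a, (a0 a : Real.Angle) = th (p a) q) →
    ∃ a1 : P → ℝ, Continuous a1 ∧ (∀ a, (a1 a : Real.Angle) = th (F (p a)) (F q)) ∧
      (∀ a, 2 * M < (p a).1 - q.1 → a0 a ∈ Ioo (-(Real.pi / 2)) (Real.pi / 2) →
        a1 a ∈ Ioo (-(Real.pi / 2)) (Real.pi / 2)) ∧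
      (∀ a, (p a).1 - q.1 < -(2 * M) → a0 a ∈ Ioo (-(3 * Real.pi / 2)) (-(Real.pi / 2)) →
        a1 a ∈ Ioo (-(3 * Real.pi / 2)) (-(Real.pi / 2)))

lemma transport {f : Ann → Ann} (hf : IsotopicToId f) {F : Strip → Strip} (hFc : Continuous F)
    (hF : IsLift f F) : ∃ M, 0 ≤ M ∧ Transp F M := by
  obtain ⟨M, h, c, hh, h0, hinj, hM, h1⟩ := iso_lift hf hFc hF
  refine ⟨M, (abs_nonneg _).trans (hM 0 (pt 0 0)), ?_⟩
  intro P _ p q a0 hp hpq ha0 hl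
  obtain ⟨L, hL, hLl, hL0⟩ := lift_htpy (P := P) (fun r => th (h r.1 (p r.2)) (h r.1 q))
    (continuous_th (hh.comp (continuous_fst.prodMk (hp.comp continuous_snd)))
      (hh.comp (continuous_fst.prodMk continuous_const))
      (fun r e => hpq _ (hinj _ e))) a0 ha0 (fun a => by simp only [h0, hl])
  refine ⟨fun a => L (1, a), hL.comp (continuous_const.prodMk continuous_id), ?_, ?_, ?_⟩
  · intro a
    rw [hLl, h1, h1, th_shift]
  · intro a ha hi
    refine cos_conn (S := (univ : Set unitInterval)) isPreconnected_univ (g := fun t => L (t, a))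
      (hL.comp (continuous_id.prodMk continuous_const)).continuousOn
      (fun t _ => cos_lift_pos ?_ (hLl (t, a))) (mem_univ 0) (mem_univ 1) (by simpa only [hL0])
    have := abs_le.1 (hM t (p a))
    have := abs_le.1 (hM t q)
    simp only
    linarith
  · intro a ha hi
    refine cos_conn_neg (S := (univ : Set unitInterval)) isPreconnected_univ
      (g := fun t => L (t, a))
      (hL.comp (continuous_id.prodMk continuous_const)).continuousOn
      (fun t _ => cos_lift_neg ?_ (hLl (t, a))) (mem_univ 0) (mem_univ 1) (by simpa only [hL0])
    have := abs_le.1 (hM t (p a))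
    have := abs_le.1 (hM t q)
    simp only
    linarith

lemma right_of_bottom {a : ℝ} (h : a ∈ Ioo (-Real.pi) 0) (hc : 0 < Real.cos a) :
    a ∈ Ioo (-(Real.pi / 2)) (Real.pi / 2) := by
  refine ⟨?_, by linarith [h.2, Real.pi_pos]⟩
  by_contra hlt
  push Not at hlt
  have := Real.cos_nonpos_of_pi_div_two_le_of_le (x := -a) (by linarith)
    (by linarith [h.1, Real.pi_pos])
  rw [Real.cos_neg] at this
  linarith

lemma left_of_bottom {a : ℝ} (h : a ∈ Ioo (-Real.pi) 0) (hc : Real.cos a < 0) :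
    a ∈ Ioo (-(3 * Real.pi / 2)) (-(Real.pi / 2)) := by
  refine ⟨by linarith [h.1, Real.pi_pos], ?_⟩
  by_contra hlt
  push Not at hlt
  have := Real.cos_nonneg_of_neg_pi_div_two_le_of_le (x := a) (by linarith)
    (by linarith [h.2, Real.pi_pos])
  linarith

/-- `A` is the normalized angle function around `Q` on `Ut`. -/
structure IsA (Um : Set Ann) (Q : Strip) (A : Strip → ℝ) : Prop where
  cont : ContinuousOn A (pr ⁻¹' Um)
  lift : ∀ z ∈ pr ⁻¹' Um, (A z : Real.Angle) = th z Q
  bot : ∀ x, A (pt x (-1)) ∈ Ioo (-Real.pi) 0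

lemma exists_IsA {X Um Up : Set Ann} (hX : IsEAC X Um Up) {Q : Strip} (hQ : Q ∈ pr ⁻¹' X) :
    ∃ A, IsA Um Q A := by
  obtain ⟨A, h1, h2, h3⟩ := exists_A hX hQ
  exact ⟨A, h1, h2, h3⟩

lemma IsA.right {Um : Set Ann} {Q : Strip} {A : Strip → ℝ} (hA : IsA Um Q A) {S : Set Strip}
    (hS : IsPreconnected S) (hSU : S ⊆ pr ⁻¹' Um) (hr : ∀ w ∈ S, Q.1 < w.1) {x : ℝ}
    (hx : pt x (-1) ∈ S) {z : Strip} (hz : z ∈ S) :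
    A z ∈ Ioo (-(Real.pi / 2)) (Real.pi / 2) :=
  cos_conn hS (hA.cont.mono hSU) (fun w hw => cos_lift_pos (hr w hw) (hA.lift w (hSU hw))) hx hz
    (right_of_bottom (hA.bot x) (cos_lift_pos (hr _ hx) (hA.lift _ (hSU hx))))

lemma IsA.left {Um : Set Ann} {Q : Strip} {A : Strip → ℝ} (hA : IsA Um Q A) {S : Set Strip}
    (hS : IsPreconnected S) (hSU : S ⊆ pr ⁻¹' Um) (hr : ∀ w ∈ S, w.1 < Q.1) {x : ℝ}
    (hx : pt x (-1) ∈ S) {z : Strip} (hz : z ∈ S) :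
    A z ∈ Ioo (-(3 * Real.pi / 2)) (-(Real.pi / 2)) :=
  cos_conn_neg hS (hA.cont.mono hSU) (fun w hw => cos_lift_neg (hr w hw) (hA.lift w (hSU hw)))
    hx hz (left_of_bottom (hA.bot x) (cos_lift_neg (hr _ hx) (hA.lift _ (hSU hx))))

lemma F_Xt {f : Ann → Ann} {F : Strip → Strip} (hF : IsLift f F) {X : Set Ann}
    (hinv : f '' X = X) {z : Strip} (hz : z ∈ pr ⁻¹' X) : F z ∈ pr ⁻¹' X := by
  show pr (F z) ∈ X
  rw [hF.1, ← hinv]; exact ⟨_, hz, rfl⟩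

lemma F_Xt_iff {f : Ann → Ann} (hfi : Injective f) {F : Strip → Strip} (hF : IsLift f F)
    {X : Set Ann} (hinv : f '' X = X) {z : Strip} : F z ∈ pr ⁻¹' X ↔ z ∈ pr ⁻¹' X := by
  refine ⟨fun h => ?_, F_Xt hF hinv⟩
  have h' : pr (F z) ∈ X := h
  rw [hF.1, ← hinv] at h'
  obtain ⟨a, ha, e⟩ := h'
  show pr z ∈ X
  rw [← hfi e]; exact ha

lemma no_swap {f : Ann → Ann} (hfi : Injective f) {F : Strip ≃ₜ Strip}
    (hF : IsLift f ⇑F) {X Um Up : Set Ann} (hX : IsEAC X Um Up) (hinv : f '' X = X)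
    {M : ℝ} (hT : Transp F M) :
    ∀ z ∈ pr ⁻¹' Um, F z ∈ pr ⁻¹' Um := by
  have hpre : IsPreconnected (⇑F '' (pr ⁻¹' Um)) :=
    (pathConn_Ut hX).isConnected.isPreconnected.image _ F.continuous.continuousOn
  have hoff : ∀ z ∈ ⇑F '' (pr ⁻¹' Um), z ∉ pr ⁻¹' X := by
    rintro _ ⟨z, hz, rfl⟩ h
    exact Um_notX hX hz ((F_Xt_iff hfi hF hinv).1 h)
  have ho : F (pt 0 (-1)) ∈ ⇑F '' (pr ⁻¹' Um) := ⟨_, bot_mem hX 0, rfl⟩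
  rcases notX_cases hX (hoff _ ho) with h | h
  · intro z hz
    exact sub_Um hX hpre hoff ho h ⟨z, hz, rfl⟩
  exfalso
  have hsw : ∀ z ∈ pr ⁻¹' Um, F z ∈ pr ⁻¹' Up := fun z hz => sub_Up hX hpre hoff ho h ⟨z, hz, rfl⟩
  obtain ⟨η, hη1, hη2, hηX, hηU⟩ := exists_low hX 0
  set q := F.symm (pt 0 η) with hq
  have hFq : F q = pt 0 η := F.apply_symm_apply _
  have hqX : q ∈ pr ⁻¹' X := by
    rw [← F_Xt_iff hfi hF hinv, hFq]; exact hηX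
  have hq1 := (Xt_interior hX hqX).1
  have him : ∀ s : ℝ, (dz (pt s (-1)) q).im < 0 := by
    intro s
    simp only [dz]
    rw [pt_snd _ le_rfl (by norm_num)]; linarith
  have hpc : Continuous fun s : ℝ => pt s (-1) := continuous_pt continuous_id continuous_const
  obtain ⟨a1, ha1, hl1, hp, hm⟩ := hT ℝ (fun s => pt s (-1)) q
    (fun s => Complex.arg (dz (pt s (-1)) q)) hpc
    (fun s e => bot_not_X hX s (by rw [e]; exact hqX)) (by
      rw [continuous_iff_continuousAt]
      intro s
      have hc : ContinuousAt (fun s : ℝ => dz (pt s (-1)) q) s :=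
        (continuous_dz.comp (hpc.prodMk continuous_const)).continuousAt
      refine ContinuousAt.comp (f := fun s : ℝ => dz (pt s (-1)) q) (Complex.continuousAt_arg ?_) hc
      rw [Complex.mem_slitPlane_iff]
      right
      exact (him s).ne) (fun s => rfl)
  rw [hFq] at hl1
  have hcut : ∀ s : ℝ, (dz (F (pt s (-1))) (pt 0 η)).re ≠ 0 ∨ 0 < (dz (F (pt s (-1))) (pt 0 η)).im := by
    intro s
    by_contra hcon
    push Not at hcon
    simp only [dz, pt_fst] at hcon
    rw [pt_snd _ hη1.le hη2.le] at hcon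
    have hup := hsw _ (bot_mem hX s)
    set w := F (pt s (-1))
    have hw : w = pt 0 w.2 := by
      rw [← pt_self w]
      have : w.1 = 0 := by linarith [hcon.1]
      rw [this]
      rw [pt_snd _ (snd_ge w) (snd_le w)]
    rcases (sub_nonpos.1 hcon.2).lt_or_eq with h | h
    · have := hηU _ (snd_ge w) h
      rw [← hw] at this
      exact Um_notUp hX this hup
    · rw [h] at hw
      rw [← hw] at hηX
      exact Up_notX hX hup hηX
  have hBc : Continuous fun s : ℝ => br (dz (F (pt s (-1))) (pt 0 η)) := by
    rw [continuous_iff_continuousAt]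
    intro s
    have hc : ContinuousAt (fun s : ℝ => dz (F (pt s (-1))) (pt 0 η)) s :=
      (continuous_dz.comp ((F.continuous.comp hpc).prodMk continuous_const)).continuousAt
    exact ContinuousAt.comp (f := fun s : ℝ => dz (F (pt s (-1))) (pt 0 η)) (br_cont (hcut s)) hc
  have hne : ∀ s : ℝ, F (pt s (-1)) ≠ pt 0 η := by
    intro s e
    have := Up_notX hX (hsw _ (bot_mem hX s))
    rw [e] at this
    exact this hηX
  have hcoe : ∀ s : ℝ, (a1 s : Real.Angle) = br (dz (F (pt s (-1))) (pt 0 η)) := by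
    intro s
    rw [hl1, br_coe (dz_ne (hne s))]; rfl
  set sp : ℝ := q.1 + 2 * |M| + 1 with hsp
  set sm : ℝ := q.1 - 2 * |M| - 1 with hsm
  have hconst := lifts_const (S := (univ : Set ℝ)) isPreconnected_univ ha1.continuousOn
    hBc.continuousOn (fun s _ => hcoe s) (mem_univ sp) (mem_univ sm)
  have hle := le_abs_self M
  have hab := abs_nonneg M
  have e1 : a1 sp ∈ Ioo (-(Real.pi / 2)) (Real.pi / 2) := by
    apply hp
    · rw [pt_fst]; linarith
    · apply right_of_bottom (arg_mem_of_im_neg (him sp))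
      exact cos_lift_pos (z := pt sp (-1)) (w := q) (by rw [pt_fst]; linarith) rfl
  have e2 : a1 sm ∈ Ioo (-(3 * Real.pi / 2)) (-(Real.pi / 2)) := by
    apply hm
    · rw [pt_fst]; linarith
    · apply left_of_bottom (arg_mem_of_im_neg (him sm))
      exact cos_lift_neg (z := pt sm (-1)) (w := q) (by rw [pt_fst]; linarith) rfl
  have b1 := br_gt (dz (F (pt sp (-1))) (pt 0 η))
  have b2 := br_lt (hcut sp)
  have b3 := br_gt (dz (F (pt sm (-1))) (pt 0 η))
  have := angle_eq_of_lt (hcoe sp) (by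
    rw [abs_lt]; constructor <;> linarith [e1.1, e1.2, Real.pi_pos])
  linarith [e2.2]

lemma one_step {f : Ann → Ann} {F : Strip ≃ₜ Strip}
    (hF : IsLift f ⇑F) {X Um Up : Set Ann} (hX : IsEAC X Um Up)
    {M : ℝ} (hT : Transp F M) (hU : ∀ z ∈ pr ⁻¹' Um, F z ∈ pr ⁻¹' Um)
    {Q : Strip} (hQ : Q ∈ pr ⁻¹' X) {A A' : Strip → ℝ} (hA : IsA Um Q A) (hA' : IsA Um (F Q) A')
    {z : Strip} (hz : z ∈ pr ⁻¹' Um) :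
    (2 * M < z.1 - Q.1 → A z ∈ Ioo (-(Real.pi / 2)) (Real.pi / 2) →
      A' (F z) ∈ Ioo (-(Real.pi / 2)) (Real.pi / 2)) ∧
    (z.1 - Q.1 < -(2 * M) → A z ∈ Ioo (-(3 * Real.pi / 2)) (-(Real.pi / 2)) →
      A' (F z) ∈ Ioo (-(3 * Real.pi / 2)) (-(Real.pi / 2))) := by
  set U := pr ⁻¹' Um with hUdef
  obtain ⟨a1, ha1, hl1, hp, hm⟩ := hT U (fun z => z) Q (fun z => A z) continuous_subtype_val
    (fun z e => Um_notX hX z.2 (by rw [e]; exact hQ))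
    (continuousOn_iff_continuous_domRestrict.1 hA.cont) (fun z => hA.lift z z.2)
  have hc : Continuous fun z : U => A' (F z) := by
    have : Continuous fun z : U => (⟨F z, hU z z.2⟩ : U) :=
      (F.continuous.comp continuous_subtype_val).subtype_mk _
    exact (continuousOn_iff_continuous_domRestrict.1 hA'.cont).comp this
  have hpre : IsPreconnected (univ : Set U) :=
    (isPreconnected_iff_preconnectedSpace.1
      (pathConn_Ut hX).isConnected.isPreconnected).isPreconnected_univ
  have hcoe : ∀ z : U, (a1 z : Real.Angle) = A' (F z) := by
    intro z
    rw [hl1, hA'.lift _ (hU z z.2)]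
  obtain ⟨x, hx⟩ := joined_bot hX (hU _ (bot_mem hX 0))
  obtain ⟨δ, hδ⟩ := hx
  obtain ⟨R, hR⟩ : ∃ R, ∀ w ∈ range δ, |w.1| ≤ R := by
    have := (isCompact_range δ.continuous).exists_bound_of_continuousOn
      (f := fun z : Strip => z.1) continuous_fst.continuousOn
    simpa using this
  obtain ⟨k, hk⟩ := exists_nat_gt (max (Q.1 + 2 * |M|) ((F Q).1 + R))
  have hk1 := (le_max_left _ _).trans_lt hk
  have hk2 := (le_max_right _ _).trans_lt hk
  have hle := le_abs_self M
  have hab := abs_nonneg M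
  have hzk : pt (k : ℝ) (-1) ∈ U := bot_mem hX k
  have e1 : a1 ⟨_, hzk⟩ ∈ Ioo (-(Real.pi / 2)) (Real.pi / 2) := by
    apply hp
    · show 2 * M < (k : ℝ) - Q.1
      linarith
    · exact right_of_bottom (hA.bot k) (cos_lift_pos (by rw [pt_fst]; linarith) (hA.lift _ hzk))
  have hFk : F (pt (k : ℝ) (-1)) = shiftPt k (F (pt 0 (-1))) := by
    rw [← lift_shift hF, shiftPt_pt]; simp
  have e2 : A' (F (pt (k : ℝ) (-1))) ∈ Ioo (-(Real.pi / 2)) (Real.pi / 2) := by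
    refine hA'.right (S := shiftPt k '' range δ) ((isPreconnected_range δ.continuous).image _
      (continuous_shiftPt _).continuousOn) ?_ ?_ (x := x + (k : ℤ)) ?_ ?_
    · rintro _ ⟨_, ⟨t, rfl⟩, rfl⟩
      exact (mem_shift _).2 (hδ t)
    · rintro _ ⟨w, hw, rfl⟩
      have := abs_le.1 (hR w hw)
      simp only [shiftPt]
      push_cast
      linarith
    · exact ⟨pt x (-1), ⟨1, δ.target⟩, rfl⟩
    · rw [hFk]
      exact ⟨_, ⟨0, δ.source⟩, rfl⟩
  have e3 := angle_eq_of_lt (hcoe ⟨_, hzk⟩) (by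
    rw [abs_lt]; constructor <;> linarith [e1.1, e1.2, e2.1, e2.2, Real.pi_pos])
  have hconst := lifts_const hpre ha1.continuousOn hc.continuousOn (fun s _ => hcoe s)
    (mem_univ ⟨z, hz⟩) (mem_univ ⟨_, hzk⟩)
  have e4 : a1 ⟨z, hz⟩ = A' (F z) := by
    simp only at hconst e3
    linarith
  rw [← e4]
  exact ⟨hp ⟨z, hz⟩, hm ⟨z, hz⟩⟩

lemma iter_Um {F : Strip → Strip} {U : Set Strip} (hU : ∀ z ∈ U, F z ∈ U) (n : ℕ) {z : Strip}
    (hz : z ∈ U) : F^[n] z ∈ U := by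
  induction n with
  | zero => exact hz
  | succ n ih => rw [iterate_succ_apply']; exact hU _ ih

lemma n_steps_right {f : Ann → Ann} {F : Strip ≃ₜ Strip}
    (hF : IsLift f ⇑F) {X Um Up : Set Ann} (hX : IsEAC X Um Up) (hinv : f '' X = X)
    {M : ℝ} (hT : Transp F M) (hU : ∀ z ∈ pr ⁻¹' Um, F z ∈ pr ⁻¹' Um)
    {Q : Strip} (hQ : Q ∈ pr ⁻¹' X) {z : Strip} (hz : z ∈ pr ⁻¹' Um) (n : ℕ)
    (h0 : ∀ A, IsA Um Q A → A z ∈ Ioo (-(Real.pi / 2)) (Real.pi / 2))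
    (hsep : ∀ i < n, 2 * M < (F^[i] z).1 - (F^[i] Q).1) :
    ∀ A, IsA Um (F^[n] Q) A → A (F^[n] z) ∈ Ioo (-(Real.pi / 2)) (Real.pi / 2) := by
  have hXi : ∀ i, F^[i] Q ∈ pr ⁻¹' X := fun i => iter_Um (fun z hz => F_Xt hF hinv hz) i hQ
  induction n with
  | zero => exact h0
  | succ n ih =>
    intro A' hA'
    obtain ⟨A2, hA2⟩ := exists_IsA hX (hXi n)
    have := ih (fun i hi => hsep i (by omega)) A2 hA2
    rw [iterate_succ_apply'] at hA' ⊢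
    exact (one_step hF hX hT hU (hXi n) hA2 hA' (iter_Um hU n hz)).1 (hsep n (by omega)) this

lemma n_steps_left {f : Ann → Ann} {F : Strip ≃ₜ Strip}
    (hF : IsLift f ⇑F) {X Um Up : Set Ann} (hX : IsEAC X Um Up) (hinv : f '' X = X)
    {M : ℝ} (hT : Transp F M) (hU : ∀ z ∈ pr ⁻¹' Um, F z ∈ pr ⁻¹' Um)
    {Q : Strip} (hQ : Q ∈ pr ⁻¹' X) {z : Strip} (hz : z ∈ pr ⁻¹' Um) (n : ℕ)
    (h0 : ∀ A, IsA Um Q A → A z ∈ Ioo (-(3 * Real.pi / 2)) (-(Real.pi / 2)))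
    (hsep : ∀ i < n, (F^[i] z).1 - (F^[i] Q).1 < -(2 * M)) :
    ∀ A, IsA Um (F^[n] Q) A → A (F^[n] z) ∈ Ioo (-(3 * Real.pi / 2)) (-(Real.pi / 2)) := by
  have hXi : ∀ i, F^[i] Q ∈ pr ⁻¹' X := fun i => iter_Um (fun z hz => F_Xt hF hinv hz) i hQ
  induction n with
  | zero => exact h0
  | succ n ih =>
    intro A' hA'
    obtain ⟨A2, hA2⟩ := exists_IsA hX (hXi n)
    have := ih (fun i hi => hsep i (by omega)) A2 hA2
    rw [iterate_succ_apply'] at hA' ⊢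
    exact (one_step hF hX hT hU (hXi n) hA2 hA' (iter_Um hU n hz)).2 (hsep n (by omega)) this

/-- empirical measure -/
noncomputable def emp (f : Ann → Ann) (p : Ann) (n : ℕ) : Measure Ann :=
  ((n : ENNReal)⁻¹) • ∑ i ∈ Finset.range n, Measure.dirac (f^[i] p)

lemma emp_prob (f : Ann → Ann) (p : Ann) {n : ℕ} (hn : n ≠ 0) : IsProbabilityMeasure (emp f p n) := by
  constructor
  unfold emp
  rw [Measure.smul_apply, Measure.finsetSum_apply]
  simp
  rw [ENNReal.inv_mul_cancel (by exact_mod_cast hn) (by simp)]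

lemma emp_integral (f : Ann → Ann) (p : Ann) (n : ℕ) (g : Ann → ℝ) :
    ∫ a, g a ∂(emp f p n) = (n : ℝ)⁻¹ * ∑ i ∈ Finset.range n, g (f^[i] p) := by
  unfold emp
  rw [integral_smul_measure, integral_finsetSum_measure]
  · simp
  · intro i _
    exact integrable_dirac (by simp)

lemma emp_off (f : Ann → Ann) {X : Set Ann} (hXm : MeasurableSet X) (hf : MapsTo f X X) {p : Ann}
    (hp : p ∈ X) (n : ℕ) : emp f p n Xᶜ = 0 := by
  unfold emp
  rw [Measure.smul_apply, Measure.finsetSum_apply]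
  simp only [smul_eq_mul, mul_eq_zero]
  right
  apply Finset.sum_eq_zero
  intro i _
  rw [Measure.dirac_apply' _ hXm.compl]
  simp [hf.iterate i hp]

lemma meas_le {f : Ann → Ann} (hfc : Continuous f) {X : Set Ann} (hX : IsCompact X)
    (hf : MapsTo f X X) {ψ : Ann → ℝ} (hψ : Continuous ψ) {r : ℝ}
    (h : ∀ a > r, ∀ C : ℝ, ∃ n : ℕ, ∃ p ∈ X, ∑ i ∈ Finset.range n, ψ (f^[i] p) < a * n - C) :
    ∃ μ : Measure Ann, IsProbabilityMeasure μ ∧ Measure.map f μ = μ ∧ μ Xᶜ = 0 ∧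
      ∫ a, ψ a ∂μ ≤ r := by
  obtain ⟨B, hB⟩ : ∃ B, ∀ a, |ψ a| ≤ B := by
    obtain ⟨B, hB⟩ := isCompact_univ.exists_bound_of_continuousOn hψ.continuousOn
    exact ⟨B, fun a => hB a (mem_univ a)⟩
  have hB0 : 0 ≤ B := (abs_nonneg _).trans (hB (pr (pt 0 0)))
  choose n p hp hlt using fun m : ℕ => h (r + 1 / (m + 1)) (by
    have : (0:ℝ) < 1 / (m + 1) := by positivity
    linarith) (m + 1)
  have hsum : ∀ m, -(B * n m) ≤ ∑ i ∈ Finset.range (n m), ψ (f^[i] (p m)) := by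
    intro m
    have := Finset.sum_le_sum (s := Finset.range (n m)) (f := fun _ => -B)
      (g := fun i => ψ (f^[i] (p m))) (fun i _ => (abs_le.1 (hB _)).1)
    simp at this
    linarith
  have hbig : ∀ m : ℕ, (m : ℝ) + 1 < (|r| + 1 + B) * n m := by
    intro m
    have h1 := hlt m
    have h2 := hsum m
    have h3 : (1:ℝ) / (m + 1) ≤ 1 := by
      rw [div_le_one (by positivity)]; linarith [(Nat.cast_nonneg m : (0:ℝ) ≤ m)]
    have h4 : (0:ℝ) ≤ n m := Nat.cast_nonneg _
    nlinarith [le_abs_self r]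
  have hn0 : ∀ m, n m ≠ 0 := by
    intro m h0
    have := hbig m
    rw [h0] at this
    simp at this
    linarith [(Nat.cast_nonneg m : (0:ℝ) ≤ m)]
  have hninv : Tendsto (fun m => ((n m : ℝ))⁻¹) atTop (𝓝 0) := by
    have hc : 0 < |r| + 1 + B := by positivity
    have : Tendsto (fun m : ℕ => (n m : ℝ)) atTop atTop := by
      refine tendsto_atTop_mono (f := fun m : ℕ => (m : ℝ) / (|r| + 1 + B)) ?_
        (tendsto_natCast_atTop_atTop.atTop_div_const hc)
      intro m
      rw [div_le_iff₀ hc]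
      linarith [hbig m, mul_comm (n m : ℝ) (|r| + 1 + B)]
    exact tendsto_inv_atTop_zero.comp this
  let P : ℕ → ProbabilityMeasure Ann := fun m => ⟨emp f (p m) (n m), emp_prob f (p m) (hn0 m)⟩
  let 𝒰 : Ultrafilter ℕ := hyperfilter ℕ
  have h𝒰 : (𝒰 : Filter ℕ) ≤ atTop := Nat.hyperfilter_le_atTop
  obtain ⟨μ, hμ⟩ : ∃ μ, Tendsto P 𝒰 (𝓝 μ) := by
    obtain ⟨μ, -, hμ⟩ := isCompact_univ.ultrafilter_le_nhds (𝒰.map P) (by simp)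
    exact ⟨μ, hμ⟩
  have hInt0 : ∀ g : BoundedContinuousFunction Ann ℝ,
      Tendsto (fun m => (n m : ℝ)⁻¹ * ∑ i ∈ Finset.range (n m), g (f^[i] (p m))) 𝒰
        (𝓝 (∫ a, g a ∂(μ : Measure Ann))) := by
    intro g
    have := ProbabilityMeasure.tendsto_iff_forall_integral_tendsto.1 hμ g
    refine this.congr (fun m => ?_)
    exact emp_integral f (p m) (n m) g
  refine ⟨μ, inferInstance, ?_, ?_, ?_⟩
  · have : IsFiniteMeasure (Measure.map f (μ : Measure Ann)) := inferInstance
    refine ext_of_forall_integral_eq_of_IsFiniteMeasure fun g => ?_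
    rw [integral_map hfc.aemeasurable g.continuous.aestronglyMeasurable]
    have h1 := hInt0 g
    have h2 := hInt0 (g.compContinuous ⟨f, hfc⟩)
    have h3 : Tendsto (fun m => (n m : ℝ)⁻¹ * (g (f^[n m] (p m)) - g (p m))) 𝒰 (𝓝 0) := by
      have h4 : Tendsto (fun m => (n m : ℝ)⁻¹ * (2 * ‖g‖)) 𝒰 (𝓝 0) := by
        simpa using (hninv.mono_left h𝒰).mul_const (2 * ‖g‖)
      refine squeeze_zero_norm (fun m => ?_) h4
      rw [norm_mul, Real.norm_of_nonneg (by positivity)]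
      gcongr
      calc ‖g (f^[n m] (p m)) - g (p m)‖ ≤ ‖g (f^[n m] (p m))‖ + ‖g (p m)‖ := norm_sub_le _ _
        _ ≤ ‖g‖ + ‖g‖ := add_le_add (g.norm_coe_le_norm _) (g.norm_coe_le_norm _)
        _ = 2 * ‖g‖ := by ring
    have h5 := h1.add h3
    rw [add_zero] at h5
    refine tendsto_nhds_unique (h2.congr ?_) h5
    intro m
    rw [← mul_add]
    congr 1
    have e1 := Finset.sum_range_succ (fun i => g (f^[i] (p m))) (n m)
    have e2 := Finset.sum_range_succ' (fun i => g (f^[i] (p m))) (n m)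
    simp only [iterate_succ_apply', iterate_zero, id] at e1 e2
    simp only [BoundedContinuousFunction.compContinuous_apply, ContinuousMap.coe_mk]
    linarith
  · have := ProbabilityMeasure.le_liminf_measure_open_of_tendsto hμ hX.isClosed.isOpen_compl
    refine le_antisymm (this.trans ?_) bot_le
    have h0 : (fun m => (P m : Measure Ann) Xᶜ) = fun _ => 0 := by
      ext m
      exact emp_off f hX.measurableSet hf (hp m) (n m)
    rw [h0]; simp
  · have h1 := hInt0 (BoundedContinuousFunction.ofNormedAddCommGroup ψ hψ B hB)
    have h2 : Tendsto (fun m : ℕ => r + 1 / ((m : ℝ) + 1)) 𝒰 (𝓝 (r + 0)) :=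
      (tendsto_const_nhds.add tendsto_one_div_add_atTop_nhds_zero_nat).mono_left h𝒰
    rw [add_zero] at h2
    refine le_of_tendsto_of_tendsto' h1 h2 (fun m => ?_)
    have hpos : (0:ℝ) < n m := by exact_mod_cast Nat.pos_of_ne_zero (hn0 m)
    rw [inv_mul_le_iff₀ hpos]
    have := hlt m
    simp only [BoundedContinuousFunction.coe_ofNormedAddCommGroup]
    nlinarith [(Nat.cast_nonneg m : (0:ℝ) ≤ m)]

lemma measure_alt {f : Ann → Ann} (hfc : Continuous f) {X : Set Ann} (hX : IsCompact X)
    (hinv : f '' X = X) {F : Strip → Strip} (hF : IsLift f F) {φ : Ann → ℝ} (hφ : Continuous φ)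
    (hφF : ∀ z : Strip, φ (pr z) = (F z).1 - z.1) {r : ℝ} (hr : r ∉ rotMes f φ X) :
    (∃ a > r, ∃ C : ℝ, ∀ (n : ℕ), ∀ w ∈ pr ⁻¹' X, a * n - C ≤ (F^[n] w).1 - w.1) ∨
    (∃ a < r, ∃ C : ℝ, ∀ (n : ℕ), ∀ w ∈ pr ⁻¹' X, (F^[n] w).1 - w.1 ≤ a * n + C) := by
  have hmaps : MapsTo f X X := by
    intro x hx; rw [← hinv]; exact ⟨x, hx, rfl⟩
  have hsum : ∀ (n : ℕ) (w : Strip),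
      ∑ i ∈ Finset.range n, φ (f^[i] (pr w)) = (F^[n] w).1 - w.1 := by
    intro n w
    have hpr : ∀ i : ℕ, f^[i] (pr w) = pr (F^[i] w) := by
      intro i
      induction i with
      | zero => rfl
      | succ i ih => rw [iterate_succ_apply', iterate_succ_apply', ih, hF.1]
    induction n with
    | zero => simp
    | succ n ih =>
      rw [Finset.sum_range_succ, ih, hpr, hφF, iterate_succ_apply']
      ring
  by_contra hcon
  push Not at hcon
  obtain ⟨h1, h2⟩ := hcon
  obtain ⟨μ, hμp, hμi, hμX, hμr⟩ := meas_le hfc hX hmaps hφ (r := r) (by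
    intro a ha C
    obtain ⟨n, w, hw, hlt⟩ := h1 a ha C
    exact ⟨n, pr w, hw, by rw [hsum]; exact hlt⟩)
  obtain ⟨ν, hνp, hνi, hνX, hνr⟩ := meas_le hfc hX hmaps hφ.neg (r := -r) (by
    intro a ha C
    obtain ⟨n, w, hw, hlt⟩ := h2 (-a) (by linarith) C
    refine ⟨n, pr w, hw, ?_⟩
    simp only [Pi.neg_apply]
    rw [Finset.sum_neg_distrib, hsum]; linarith)
  simp only [Pi.neg_apply] at hνr
  rw [integral_neg] at hνr
  set u := ∫ a, φ a ∂μ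
  set v := ∫ a, φ a ∂ν
  have hu : u ≤ r := hμr
  have hv : r ≤ v := by linarith
  obtain ⟨t, ht0, ht1, ht⟩ : ∃ t : ℝ, 0 ≤ t ∧ t ≤ 1 ∧ (1 - t) * u + t * v = r := by
    by_cases huv : u = v
    · exact ⟨0, le_rfl, by norm_num, by linarith⟩
    · have hlt : 0 < v - u := by
        rcases (hu.trans hv).lt_or_eq with h | h
        · linarith
        · exact absurd h huv
      refine ⟨(r - u) / (v - u), div_nonneg (by linarith) hlt.le, ?_, ?_⟩
      · rw [div_le_one hlt]; linarith
      · field_simp; ring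
  have hintg : ∀ (κ : Measure Ann) [IsProbabilityMeasure κ], Integrable φ κ := by
    intro κ _
    exact hφ.integrable_of_hasCompactSupport (HasCompactSupport.of_compactSpace φ)
  apply hr
  refine ⟨ENNReal.ofReal (1 - t) • μ + ENNReal.ofReal t • ν, ?_, ?_, ?_, ?_⟩
  · constructor
    simp
    rw [← ENNReal.ofReal_add (by linarith) ht0]; simp
  · rw [Measure.map_add _ _ hfc.measurable, Measure.map_smul, Measure.map_smul, hμi, hνi]
  · simp [hμX, hνX]
  · rw [integral_add_measure ((hintg μ).smul_measure (by simp)) ((hintg ν).smul_measure (by simp)),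
      integral_smul_measure, integral_smul_measure, ENNReal.toReal_ofReal (by linarith),
      ENNReal.toReal_ofReal ht0]
    simpa using ht

/-- arcs parametrized by the unit interval inside the real line -/
structure Arc (a : ℝ → Strip) : Prop where
  cont : Continuous a
  inj : InjOn a (Icc 0 1)

lemma Icc_sub_mem {s t u : ℝ} (hs : 0 ≤ s) (hst : s ≤ t) (ht : t ≤ 1) (hu : u ∈ Icc (0:ℝ) 1) :
    s + u * (t - s) ∈ Icc (0:ℝ) 1 :=
  ⟨by nlinarith [hu.1], by nlinarith [hu.2]⟩

lemma Arc.sub {a : ℝ → Strip} (ha : Arc a) {s t : ℝ} (hs : 0 ≤ s) (hst : s < t) (ht : t ≤ 1) :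
    Arc (fun u => a (s + u * (t - s))) := by
  refine ⟨ha.cont.comp (by fun_prop), ?_⟩
  intro u hu v hv e
  have mu : s + u * (t - s) ∈ Icc (0:ℝ) 1 := Icc_sub_mem hs hst.le ht hu
  have mv : s + v * (t - s) ∈ Icc (0:ℝ) 1 := Icc_sub_mem hs hst.le ht hv
  have := ha.inj mu mv e
  have h0 : t - s ≠ 0 := (sub_pos.2 hst).ne'
  have h1 : u * (t - s) = v * (t - s) := by linarith
  exact mul_right_cancel₀ h0 h1

lemma arc_seg {z w : Strip} (h : z ≠ w) : Arc (seg z w) :=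
  ⟨continuous_seg z w, fun _ hs _ ht e => seg_inj h hs ht e⟩

lemma arc_join {a τ : ℝ → Strip} (ha : Arc a) (hτ : Arc τ) (h0 : a 0 ∉ τ '' Icc 0 1)
    (h1 : τ 1 ∉ a '' Icc 0 1) (hm : ∃ t ∈ Icc (0:ℝ) 1, a t ∈ τ '' Icc 0 1) :
    ∃ γ : ℝ → Strip, Arc γ ∧ γ 0 = a 0 ∧ γ 1 = τ 1 ∧
      (∀ t ∈ Icc (0:ℝ) 1, γ t ∈ a '' Icc 0 1 ∪ τ '' Icc 0 1) ∧
      ∃ s ∈ Ico (0:ℝ) 1, γ (1 / 2) = τ s := by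
  have hcl : IsClosed (τ '' Icc 0 1) := (isCompact_Icc.image hτ.cont).isClosed
  have hcomp : IsCompact (Icc (0:ℝ) 1 ∩ a ⁻¹' (τ '' Icc 0 1)) :=
    isCompact_Icc.inter_right (hcl.preimage ha.cont)
  obtain ⟨t, ht, hta⟩ := hm
  obtain ⟨t0, ⟨ht0, ⟨s0, hs0, e0⟩⟩, hleast⟩ := hcomp.exists_isLeast ⟨t, ht, hta⟩
  have ht0pos : 0 < t0 := by
    rcases ht0.1.lt_or_eq with h | h
    · exact h
    · exfalso; exact h0 ⟨s0, hs0, by rw [e0, ← h]⟩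
  have hs0lt : s0 < 1 := by
    rcases hs0.2.lt_or_eq with h | h
    · exact h
    · exfalso; exact h1 ⟨t0, ht0, by rw [← e0, h]⟩
  have hd : 0 < 1 - s0 := by linarith
  have m1 : ∀ t ∈ Icc (0:ℝ) 1, t ≤ 1 / 2 → 2 * t * t0 ∈ Icc (0:ℝ) 1 := by
    intro t ht h
    exact ⟨by have := ht.1; positivity, by nlinarith [ht.1, ht0.2]⟩
  have m2 : ∀ t ∈ Icc (0:ℝ) 1, 1 / 2 < t → s0 + (2 * t - 1) * (1 - s0) ∈ Icc (0:ℝ) 1 := by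
    intro t ht h
    exact ⟨by nlinarith [hs0.1], by nlinarith [ht.2]⟩
  have mixed : ∀ t ∈ Icc (0:ℝ) 1, t ≤ 1 / 2 → ∀ t' ∈ Icc (0:ℝ) 1, 1 / 2 < t' →
      a (2 * t * t0) ≠ τ (s0 + (2 * t' - 1) * (1 - s0)) := by
    intro t ht h t' ht' h' e
    have hl := hleast ⟨m1 t ht h, by rw [mem_preimage, e]; exact ⟨_, m2 t' ht' h', rfl⟩⟩
    have : t = 1 / 2 := by nlinarith
    rw [this] at e
    have e' : τ s0 = τ (s0 + (2 * t' - 1) * (1 - s0)) := by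
      rw [← e, e0]; congr 1; ring
    have := hτ.inj hs0 (m2 t' ht' h') e'
    have h3 : 0 < (2 * t' - 1) * (1 - s0) := mul_pos (by linarith) hd
    linarith
  refine ⟨fun t => if t ≤ 1 / 2 then a (2 * t * t0) else τ (s0 + (2 * t - 1) * (1 - s0)),
    ⟨?_, ?_⟩, ?_, ?_, ?_, s0, ⟨hs0.1, hs0lt⟩, ?_⟩
  · refine Continuous.if_le (ha.cont.comp (by fun_prop)) (hτ.cont.comp (by fun_prop))
      continuous_id continuous_const ?_
    intro t ht
    rw [ht]
    norm_num
    exact e0.symm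
  · intro t ht t' ht' e
    simp only at e
    by_cases h : t ≤ 1 / 2 <;> by_cases h' : t' ≤ 1 / 2
    · rw [if_pos h, if_pos h'] at e
      have := ha.inj (m1 t ht h) (m1 t' ht' h') e
      have : t * t0 = t' * t0 := by linarith
      exact mul_right_cancel₀ ht0pos.ne' this
    · rw [if_pos h, if_neg h'] at e
      exact absurd e (mixed t ht h t' ht' (not_le.1 h'))
    · rw [if_neg h, if_pos h'] at e
      exact absurd e.symm (mixed t' ht' h' t ht (not_le.1 h))
    · rw [if_neg h, if_neg h'] at e
      have := hτ.inj (m2 t ht (not_le.1 h)) (m2 t' ht' (not_le.1 h')) e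
      have : (2 * t - 1) * (1 - s0) = (2 * t' - 1) * (1 - s0) := by linarith
      have := mul_right_cancel₀ hd.ne' this
      linarith
  · norm_num
  · norm_num
  · intro t ht
    by_cases h : t ≤ 1 / 2
    · simp only [h, if_true]
      exact Or.inl ⟨_, m1 t ht h, rfl⟩
    · simp only [h, if_false]
      exact Or.inr ⟨_, m2 t ht (not_le.1 h), rfl⟩
  · norm_num
    exact e0.symm

lemma arc_exists {V : Set Strip} (hVo : IsOpen V) (hVc : IsPreconnected V) {b z : Strip}
    (hb : b ∈ V) (hz : z ∈ V) (hbz : b ≠ z) :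
    ∃ a, Arc a ∧ a 0 = b ∧ a 1 = z ∧ ∀ t ∈ Icc (0:ℝ) 1, a t ∈ V := by
  set S : Set Strip := {z | z ∈ V ∧ (b ≠ z →
    ∃ a, Arc a ∧ a 0 = b ∧ a 1 = z ∧ ∀ t ∈ Icc (0:ℝ) 1, a t ∈ V)} with hS
  have ext : ∀ w ∈ S, ∀ u, (∀ t ∈ Icc (0:ℝ) 1, seg w u t ∈ V) → u ∈ S := by
    rintro w ⟨hwV, hw⟩ u hu
    have huV : u ∈ V := by have := hu 1 ⟨by norm_num, le_rfl⟩; rwa [seg_one] at this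
    refine ⟨huV, fun hbu => ?_⟩
    by_cases hwu : w = u
    · subst hwu; exact hw hbu
    by_cases hbw : b = w
    · subst hbw
      exact ⟨seg b u, arc_seg hbu, seg_zero _ _, seg_one _ _, hu⟩
    obtain ⟨a, ha, ha0, ha1, haV⟩ := hw hbw
    by_cases h1 : u ∈ a '' Icc 0 1
    · obtain ⟨t1, ht1, e⟩ := h1
      have h0 : 0 < t1 := by
        rcases ht1.1.lt_or_eq with h | h
        · exact h
        · rw [← h, ha0] at e; exact absurd e hbu
      refine ⟨_, ha.sub le_rfl h0 ht1.2, by simp [ha0], by simp [e], ?_⟩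
      intro t ht
      exact haV _ (Icc_sub_mem le_rfl h0.le ht1.2 ht)
    by_cases h2 : b ∈ seg w u '' Icc 0 1
    · obtain ⟨s1, hs1, e⟩ := h2
      have h0 : s1 < 1 := by
        rcases hs1.2.lt_or_eq with h | h
        · exact h
        · rw [h, seg_one] at e; exact absurd e.symm hbu
      refine ⟨_, (arc_seg hwu).sub hs1.1 h0 le_rfl, by simp [e], by simp [seg_one], ?_⟩
      intro t ht
      exact hu _ (Icc_sub_mem hs1.1 h0.le le_rfl ht)
    · obtain ⟨γ, hγ, g0, g1, hr, -⟩ := arc_join ha (arc_seg hwu) (by rwa [ha0])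
        (by rwa [seg_one]) ⟨1, ⟨by norm_num, le_rfl⟩, 0, ⟨le_rfl, by norm_num⟩, by
          rw [seg_zero, ha1]⟩
      refine ⟨γ, hγ, by rw [g0, ha0], by rw [g1, seg_one], ?_⟩
      intro t ht
      rcases hr t ht with ⟨s, hs, e⟩ | ⟨s, hs, e⟩
      · rw [← e]; exact haV s hs
      · rw [← e]; exact hu s hs
  have hSo : IsOpen S := by
    rw [Metric.isOpen_iff]
    intro w hw
    obtain ⟨r, hr, h⟩ := Metric.isOpen_iff.1 hVo w hw.1
    exact ⟨r, hr, fun u hu => ext w hw u fun t ht => h (seg_mem_ball hu ht)⟩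
  have hSc : IsOpen (V \ S) := by
    rw [Metric.isOpen_iff]
    rintro u ⟨huV, huS⟩
    obtain ⟨r, hr, h⟩ := Metric.isOpen_iff.1 hVo u huV
    refine ⟨r, hr, fun w hw => ⟨h hw, fun hwS => huS (ext w hwS u fun t ht => ?_)⟩⟩
    have : seg w u t = seg u w (1 - t) := by
      unfold seg
      congr 1 <;> ring
    rw [this]
    exact h (seg_mem_ball hw ⟨by linarith [ht.2], by linarith [ht.1]⟩)
  have key := (isPreconnected_iff_subset_of_disjoint.1 hVc) S (V \ S) hSo hSc (by
      intro a ha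
      by_cases h : a ∈ S
      · exact Or.inl h
      · exact Or.inr ⟨ha, h⟩) (by
      ext a; simp only [mem_inter_iff, mem_empty_iff_false, iff_false]
      rintro ⟨_, h1, h2⟩
      exact h2.2 h1)
  rcases key with h | h
  · exact (h hz).2 hbz
  · exact absurd ⟨hb, fun h => absurd rfl h⟩ (h hb).2

/-- union of the lower vertical cuts -/
def Cuts (η : ℝ) : Set Strip := {z | (∃ j : ℤ, z.1 = j) ∧ (z.2 : ℝ) ≤ η}

lemma isClosed_Cuts (η : ℝ) : IsClosed (Cuts η) := by
  have : Cuts η = (fun z : Strip => ((z.1 : ℝ) : AddCircle (1:ℝ))) ⁻¹' {0} ∩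
      {z | (z.2 : ℝ) ≤ η} := by
    ext z
    simp only [Cuts, mem_ofPred_eq, mem_inter_iff, mem_preimage, mem_singleton_iff]
    rw [AddCircle.coe_eq_zero_iff]
    simp [eq_comm]
  rw [this]
  exact (isClosed_singleton.preimage ((AddCircle.continuous_mk' (1 : ℝ)).comp continuous_fst)).inter
    (isClosed_le continuous_h continuous_const)

lemma comp_eq {Ω S : Set Strip} (hS : IsPreconnected S) (hSΩ : S ⊆ Ω) {x y : Strip} (hx : x ∈ S)
    (hy : y ∈ S) : connectedComponentIn Ω x = connectedComponentIn Ω y :=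
  connectedComponentIn_eq (hS.subset_connectedComponentIn hx hSΩ hy)

/-- data for the lowest point of `X` on the vertical line -/
structure Low (X Um : Set Ann) (η : ℝ) : Prop where
  h1 : -1 < η
  h2 : η < 1
  mem : pt 0 η ∈ pr ⁻¹' X
  below : ∀ y, -1 ≤ y → y < η → pt 0 y ∈ pr ⁻¹' Um

lemma Low.below' {X Um : Set Ann} {η : ℝ} (h : Low X Um η) (j : ℤ) {y : ℝ} (hy : -1 ≤ y)
    (hyη : y < η) : pt j y ∈ pr ⁻¹' Um := by
  have : pt (j : ℝ) y = shiftPt j (pt 0 y) := by rw [shiftPt_pt, zero_add]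
  rw [this]; exact (mem_shift j).2 (h.below y hy hyη)

lemma Low.mem' {X Um : Set Ann} {η : ℝ} (h : Low X Um η) (j : ℤ) : pt j η ∈ pr ⁻¹' X := by
  have : pt (j : ℝ) η = shiftPt j (pt 0 η) := by rw [shiftPt_pt, zero_add]
  rw [this]; exact (mem_shift j).2 h.mem

/-- a point whose downward vertical is in `Ω` is in a fundamental component -/
lemma comp_vert {X Um Up : Set Ann} (hX : IsEAC X Um Up) {η : ℝ} {u : Strip}
    (hu : ∀ j : ℤ, u.1 ≠ j) (hv : ∀ y ∈ Icc (-1) (u.2 : ℝ), pt u.1 y ∈ pr ⁻¹' Um) :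
    ∃ k : ℤ, connectedComponentIn (pr ⁻¹' Um \ Cuts η) u =
      connectedComponentIn (pr ⁻¹' Um \ Cuts η) (pt (k + 1 / 2) (-1)) := by
  refine ⟨⌊u.1⌋, ?_⟩
  have hk1 : (⌊u.1⌋ : ℝ) < u.1 := lt_of_le_of_ne (Int.floor_le _) (fun e => hu _ e.symm)
  have hk2 := Int.lt_floor_add_one u.1
  have e1 := comp_eq (Ω := pr ⁻¹' Um \ Cuts η) (vert_preconn u.1 (-1) (u.2 : ℝ)) (by
    rintro _ ⟨y, hy, rfl⟩
    exact ⟨hv y hy, fun h => by obtain ⟨⟨j, hj⟩, _⟩ := h; exact hu j hj⟩)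
    (x := u) (y := pt u.1 (-1)) ⟨_, ⟨snd_ge u, le_rfl⟩, pt_self u⟩ ⟨_, ⟨le_rfl, snd_ge u⟩, rfl⟩
  rw [e1]
  have hrow : IsPreconnected ((fun x : ℝ => pt x (-1)) '' Ioo (⌊u.1⌋ : ℝ) (⌊u.1⌋ + 1)) :=
    isPreconnected_Ioo.image _ (continuous_pt continuous_id continuous_const).continuousOn
  refine comp_eq hrow ?_ ⟨_, ⟨hk1, hk2⟩, rfl⟩ ⟨_, ⟨by linarith, by linarith⟩, rfl⟩
  rintro _ ⟨x, hx, rfl⟩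
  refine ⟨bot_mem hX x, fun h => ?_⟩
  obtain ⟨⟨j, hj⟩, _⟩ := h
  rw [pt_fst] at hj
  rw [hj] at hx
  have a1 : ⌊u.1⌋ < j := by exact_mod_cast hx.1
  have a2 : j < ⌊u.1⌋ + 1 := by exact_mod_cast hx.2
  omega

lemma comp_cover {X Um Up : Set Ann} (hX : IsEAC X Um Up) {η : ℝ} (hη : Low X Um η) {z : Strip}
    (hz : z ∈ pr ⁻¹' Um \ Cuts η) :
    ∃ k : ℤ, connectedComponentIn (pr ⁻¹' Um \ Cuts η) z =
      connectedComponentIn (pr ⁻¹' Um \ Cuts η) (pt (k + 1 / 2) (-1)) := by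
  obtain ⟨x, δ, hδ⟩ := joined_bot hX hz.1
  have hδc : Continuous δ.extend := δ.continuous_extend
  have hδU : ∀ t, δ.extend t ∈ pr ⁻¹' Um := by
    intro t; exact hδ _
  by_cases hhit : ∃ t ∈ Icc (0:ℝ) 1, δ.extend t ∈ Cuts η
  · have hcomp : IsCompact (Icc (0:ℝ) 1 ∩ δ.extend ⁻¹' (Cuts η)) :=
      isCompact_Icc.inter_right ((isClosed_Cuts η).preimage hδc)
    obtain ⟨t, ht, hta⟩ := hhit
    obtain ⟨t1, ⟨ht1, ⟨j, hj⟩, hs⟩, hleast⟩ := hcomp.exists_isLeast ⟨t, ht, hta⟩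
    set w := δ.extend t1 with hw
    have ht1pos : 0 < t1 := by
      rcases ht1.1.lt_or_eq with h | h
      · exact h
      · exfalso
        apply hz.2
        have : w = z := by rw [hw, ← h]; simp
        rw [← this]; exact ⟨⟨j, hj⟩, hs⟩
    have hwpt : w = pt j w.2 := by rw [← hj, pt_self]
    have hsη : (w.2 : ℝ) < η := by
      rcases hs.lt_or_eq with h | h
      · exact h
      · exfalso
        have h3 := hη.mem' j
        rw [← h, ← hwpt] at h3
        exact Um_notX hX (hδU t1) h3
    have hK : IsCompact ((fun y => pt (j : ℝ) y) '' Icc (-1) (w.2 : ℝ)) :=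
      isCompact_Icc.image (continuous_pt continuous_const continuous_id)
    obtain ⟨r, hr, hthick⟩ := hK.exists_thickening_subset_open (isOpen_Ut hX) (by
      rintro _ ⟨y, hy, rfl⟩
      exact hη.below' j hy.1 (by linarith [hy.2]))
    set r' := min r (min (1 / 2) (η - w.2)) with hr'
    have hr'pos : 0 < r' := lt_min hr (lt_min (by norm_num) (by linarith))
    have hr1 : r' ≤ r := min_le_left _ _
    have hr2 : r' ≤ 1 / 2 := (min_le_right _ _).trans (min_le_left _ _)
    have hr3 : r' ≤ η - w.2 := (min_le_right _ _).trans (min_le_right _ _)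
    obtain ⟨ε, hε, hball⟩ := Metric.continuous_iff.1 hδc t1 r' hr'pos
    set t2 := max (t1 - ε / 2) (t1 / 2) with ht2
    have ht2lt : t2 < t1 := max_lt (by linarith) (by linarith)
    have ht2pos : 0 < t2 := lt_of_lt_of_le (by linarith) (le_max_right _ _)
    have hub : δ.extend t2 ∈ Metric.ball w r' := hball t2 (by
      rw [Real.dist_eq, abs_lt]
      have := le_max_left (t1 - ε / 2) (t1 / 2)
      constructor <;> linarith)
    set u := δ.extend t2 with hu
    rw [mem_ball_strip, abs_lt, abs_lt] at hub
    have hΩ : ∀ t ∈ Icc 0 t2, δ.extend t ∈ pr ⁻¹' Um \ Cuts η := by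
      intro t ht
      refine ⟨hδU t, fun h => ?_⟩
      have := hleast ⟨⟨ht.1, by linarith [ht.2, ht1.2]⟩, h⟩
      linarith [ht.2]
    have e0 := comp_eq (isPreconnected_Icc.image _ hδc.continuousOn) (by
      rintro _ ⟨t, ht, rfl⟩; exact hΩ t ht) (x := z) (y := u)
      ⟨0, ⟨le_rfl, ht2pos.le⟩, by simp⟩ ⟨t2, ⟨ht2pos.le, le_rfl⟩, rfl⟩
    rw [e0]
    apply comp_vert hX
    · intro i hi
      have huj : u.1 = j := by
        rw [hi]
        have a1 : (i : ℝ) < j + 1 := by rw [← hi, ← hj]; linarith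
        have a2 : (j : ℝ) < i + 1 := by rw [← hi, ← hj]; linarith
        have a1' : i < j + 1 := by exact_mod_cast a1
        have a2' : j < i + 1 := by exact_mod_cast a2
        have : i = j := by omega
        rw [this]
      exact (hΩ t2 ⟨ht2pos.le, le_rfl⟩).2 ⟨⟨j, huj⟩, by linarith⟩
    · intro y hy
      apply hthick
      rw [Metric.mem_thickening_iff]
      refine ⟨pt j (min y w.2), ⟨_, ⟨le_min hy.1 (snd_ge w), min_le_right _ _⟩, rfl⟩, ?_⟩
      rw [← Metric.mem_ball, mem_ball_strip, pt_fst, pt_fst, pt_snd _ hy.1 (hy.2.trans (snd_le u)),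
        pt_snd _ (le_min hy.1 (snd_ge w)) ((min_le_right _ _).trans (snd_le w)), abs_lt, abs_lt, ← hj]
      refine ⟨⟨by linarith, by linarith⟩, ?_⟩
      rcases le_total y w.2 with h | h
      · rw [min_eq_left h]; constructor <;> linarith
      · rw [min_eq_right h]; constructor <;> linarith [hy.2]
  · push Not at hhit
    have hΩ : ∀ t ∈ Icc (0:ℝ) 1, δ.extend t ∈ pr ⁻¹' Um \ Cuts η := fun t ht =>
      ⟨hδU t, hhit t ht⟩
    have e0 := comp_eq (isPreconnected_Icc.image _ hδc.continuousOn) (by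
      rintro _ ⟨t, ht, rfl⟩; exact hΩ t ht) (x := z) (y := pt x (-1))
      ⟨0, ⟨le_rfl, by norm_num⟩, by simp⟩ ⟨1, ⟨by norm_num, le_rfl⟩, by simp⟩
    rw [e0]
    apply comp_vert hX
    · intro i hi
      have h1 := hhit 1 ⟨by norm_num, le_rfl⟩
      rw [Path.extend_one] at h1
      exact h1 ⟨⟨i, hi⟩, by rw [pt_snd _ le_rfl (by norm_num)]; exact hη.h1.le⟩
    · intro y hy
      rw [pt_snd _ le_rfl (by norm_num)] at hy
      have : y = -1 := le_antisymm hy.2 hy.1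
      rw [this]; exact bot_mem hX _

/-- an access arc in the region cut along the vertical cuts -/
def ArcData (Um : Set Ann) (η : ℝ) (W : Strip → Strip) (O : Set Strip) (k : ℤ) : Prop :=
  ∃ γ : ℝ → Strip, Arc γ ∧ γ 0 = pt (k + 1 / 2) (-1) ∧ γ 1 = W (pt 0 η) ∧
    (∀ t ∈ Ico (0:ℝ) 1, γ t ∈ pr ⁻¹' Um \ Cuts η) ∧
    ∃ s ∈ Ico (0:ℝ) 1, ∃ t, -1 ≤ t ∧ t < η ∧ pt 0 t ∈ O ∧ γ s = W (pt 0 t)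

lemma not_Cuts {X Um Up : Set Ann} (hX : IsEAC X Um Up) {η : ℝ} (hη : Low X Um η) {z : Strip}
    (hz : z ∈ pr ⁻¹' X) (hne : ∀ k : ℤ, shiftPt k (pt 0 η) ≠ z) : z ∉ Cuts η := by
  rintro ⟨⟨j, hj⟩, hs⟩
  have hzpt : z = pt j z.2 := by rw [← hj, pt_self]
  rcases hs.lt_or_eq with h | h
  · have := hη.below' j (snd_ge z) h
    rw [← hzpt] at this
    exact Um_notX hX this hz
  · apply hne j
    rw [shiftPt_pt, zero_add, ← h, ← hzpt]

lemma index_arc {X Um Up : Set Ann} (hX : IsEAC X Um Up) {η : ℝ} (hη : Low X Um η)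
    {W : Strip → Strip} (hWc : Continuous W) (hWi : Injective W)
    (hWX : ∀ z ∈ pr ⁻¹' X, W z ∈ pr ⁻¹' X) (hWU : ∀ z ∈ pr ⁻¹' Um, W z ∈ pr ⁻¹' Um)
    (hne : ∀ k : ℤ, shiftPt k (pt 0 η) ≠ W (pt 0 η)) {O : Set Strip} (hO : IsOpen O)
    (hxO : pt 0 η ∈ O) : ∃ k, ArcData Um η W O k := by
  have hWx := hWX _ hη.mem
  have hcut := not_Cuts hX hη hWx hne
  have hvc : Continuous (fun t : ℝ => pt 0 t) := continuous_pt continuous_const continuous_id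
  have hopen : IsOpen ((fun t : ℝ => W (pt 0 t)) ⁻¹' ((Cuts η)ᶜ ∩ {z | -1 < (z.2 : ℝ)}) ∩
      (fun t : ℝ => pt 0 t) ⁻¹' O) :=
    ((((isClosed_Cuts η).isOpen_compl).inter (isOpen_lt continuous_const continuous_h)).preimage
      (hWc.comp hvc)).inter (hO.preimage hvc)
  obtain ⟨ε, hε, hb⟩ := Metric.isOpen_iff.1 hopen η ⟨⟨hcut, (Xt_interior hX hWx).1⟩, hxO⟩
  set t0 := max (η - ε / 2) (-1) with ht0
  have ht0η : t0 < η := max_lt (by linarith) hη.h1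
  have ht0ε : η - ε / 2 ≤ t0 := le_max_left _ _
  have ht01 : -1 ≤ t0 := le_max_right _ _
  have good : ∀ t ∈ Icc t0 η, W (pt 0 t) ∉ Cuts η ∧ -1 < ((W (pt 0 t)).2 : ℝ) ∧ pt 0 t ∈ O := by
    intro t ht
    have := hb (show t ∈ Metric.ball η ε by
      rw [Metric.mem_ball, Real.dist_eq, abs_lt]; constructor <;> linarith [ht.1, ht.2])
    exact ⟨this.1.1, this.1.2, this.2⟩
  have hd : 0 < η - t0 := by linarith
  have hpar : ∀ s ∈ Icc (0:ℝ) 1, t0 + s * (η - t0) ∈ Icc t0 η := by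
    intro s hs
    exact ⟨by nlinarith [hs.1], by nlinarith [hs.2]⟩
  have hpar' : ∀ s ∈ Ico (0:ℝ) 1, t0 + s * (η - t0) < η := by
    intro s hs
    nlinarith [hs.2]
  set τ : ℝ → Strip := fun s => W (pt 0 (t0 + s * (η - t0))) with hτdef
  have hτ : Arc τ := by
    refine ⟨hWc.comp (continuous_pt continuous_const (by fun_prop)), ?_⟩
    intro s hs s' hs' e
    have e1 := hWi e
    have e2 : ((pt 0 (t0 + s * (η - t0))).2 : ℝ) = ((pt 0 (t0 + s' * (η - t0))).2 : ℝ) := by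
      rw [e1]
    have b1 := hpar s hs
    have b2 := hpar s' hs'
    rw [pt_snd _ (by linarith [b1.1]) (by linarith [b1.2, hη.h2]),
      pt_snd _ (by linarith [b2.1]) (by linarith [b2.2, hη.h2])] at e2
    have : s * (η - t0) = s' * (η - t0) := by linarith
    exact mul_right_cancel₀ hd.ne' this
  have hτ1 : τ 1 = W (pt 0 η) := by simp [hτdef]
  have hτΩ : ∀ s ∈ Ico (0:ℝ) 1, τ s ∈ pr ⁻¹' Um \ Cuts η := by
    intro s hs
    have b := hpar s ⟨hs.1, hs.2.le⟩
    exact ⟨hWU _ (hη.below _ (by linarith [b.1]) (hpar' s hs)), (good _ b).1⟩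
  have h00 : (0:ℝ) ∈ Ico (0:ℝ) 1 := ⟨le_rfl, by norm_num⟩
  obtain ⟨k, hk⟩ := comp_cover hX hη (hτΩ 0 h00)
  set Ω := pr ⁻¹' Um \ Cuts η with hΩ
  have hΩo : IsOpen Ω := (isOpen_Ut hX).sdiff (isClosed_Cuts η)
  set b : Strip := pt (k + 1 / 2) (-1) with hbdef
  set V := connectedComponentIn Ω b with hV
  have hVo : IsOpen V := hΩo.connectedComponentIn
  have hVc : IsPreconnected V := isPreconnected_connectedComponentIn
  have hVΩ : V ⊆ Ω := connectedComponentIn_subset _ _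
  have hbΩ : b ∈ Ω := by
    refine ⟨bot_mem hX _, ?_⟩
    rintro ⟨⟨j, hj⟩, -⟩
    rw [hbdef, pt_fst] at hj
    have a1 : (k : ℝ) < j := by linarith
    have a2 : (j : ℝ) < k + 1 := by linarith
    have a1' : k < j := by exact_mod_cast a1
    have a2' : j < k + 1 := by exact_mod_cast a2
    omega
  have hbV : b ∈ V := mem_connectedComponentIn hbΩ
  have hτV : ∀ s ∈ Ico (0:ℝ) 1, τ s ∈ V := by
    intro s hs
    rw [← hk]
    exact (isPreconnected_Ico.image τ hτ.cont.continuousOn).subset_connectedComponentIn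
      ⟨0, h00, rfl⟩ (by rintro _ ⟨u, hu, rfl⟩; exact hτΩ u hu) ⟨s, hs, rfl⟩
  have hbτ : b ∉ τ '' Icc 0 1 := by
    rintro ⟨s, hs, e⟩
    have h1 := (good _ (hpar s hs)).2.1
    have h2 : ((τ s).2 : ℝ) = -1 := by rw [e, hbdef, pt_snd _ le_rfl (by norm_num)]
    change -1 < ((τ s).2 : ℝ) at h1
    linarith
  obtain ⟨a, ha, ha0, ha1, haV⟩ := arc_exists hVo hVc hbV (hτV 0 h00)
    (fun e => hbτ ⟨0, ⟨le_rfl, by norm_num⟩, e.symm⟩)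
  have hWxV : W (pt 0 η) ∉ V := fun h => Um_notX hX (hVΩ h).1 hWx
  obtain ⟨γ, hγ, g0, g1, hr, s, hs, es⟩ := arc_join ha hτ (by rwa [ha0]) (by
      rintro ⟨u, hu, e⟩
      apply hWxV
      rw [← hτ1, ← e]; exact haV u hu) ⟨1, ⟨by norm_num, le_rfl⟩, 0, ⟨le_rfl, by norm_num⟩, ha1.symm⟩
  refine ⟨k, γ, hγ, by rw [g0, ha0], by rw [g1, hτ1], ?_, 1 / 2, ⟨by norm_num, by norm_num⟩, _, ?_,
    hpar' s hs, (good _ (hpar s ⟨hs.1, hs.2.le⟩)).2.2, es⟩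
  · intro t ht
    apply hVΩ
    rcases hr t ⟨ht.1, ht.2.le⟩ with ⟨u, hu, e⟩ | ⟨u, hu, e⟩
    · rw [← e]; exact haV u hu
    · rw [← e]
      apply hτV u ⟨hu.1, ?_⟩
      rcases hu.2.lt_or_eq with h | h
      · exact h
      · exfalso
        rw [h, ← g1] at e
        have := hγ.inj ⟨by norm_num, le_rfl⟩ ⟨ht.1, ht.2.le⟩ e
        linarith [ht.2]
  · linarith [(hpar s ⟨hs.1, hs.2.le⟩).1]

/-- the vertical access arcs -/
noncomputable def va (η : ℝ) (j : ℤ) (t : unitInterval) : Strip := pt j (-1 + t * (η + 1))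

lemma va_h {η : ℝ} (h1 : -1 < η) (h2 : η < 1) (j : ℤ) (t : unitInterval) :
    ((va η j t).2 : ℝ) = -1 + t * (η + 1) :=
  pt_snd _ (by nlinarith [t.2.1]) (by nlinarith [t.2.2])

lemma va_Cuts {η : ℝ} (h1 : -1 < η) (h2 : η < 1) (j : ℤ) (t : unitInterval) :
    va η j t ∈ Cuts η :=
  ⟨⟨j, rfl⟩, by rw [va_h h1 h2]; nlinarith [t.2.2]⟩

lemma va_zero {η : ℝ} (j : ℤ) : va η j 0 = pt j (-1) := by simp [va]

lemma va_arc {X Um : Set Ann} {η : ℝ} (hη : Low X Um η) (j : ℤ) :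
    IsArcTo (pr ⁻¹' Um) (va η j) (shiftPt j (pt 0 η)) := by
  refine ⟨continuous_pt continuous_const (by fun_prop), ?_, ?_, ?_⟩
  · intro s t e
    have e2 : ((va η j s).2 : ℝ) = (va η j t).2 := by rw [e]
    rw [va_h hη.h1 hη.h2, va_h hη.h1 hη.h2] at e2
    have : (s : ℝ) * (η + 1) = t * (η + 1) := by linarith
    exact Subtype.ext (mul_right_cancel₀ (by linarith [hη.h1]) this)
  · intro t ht
    have ht1 : (t : ℝ) < 1 := lt_of_le_of_ne t.2.2 (fun e => ht (Subtype.ext e))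
    exact hη.below' j (by nlinarith [t.2.1, hη.h1]) (by nlinarith [hη.h1])
  · rw [shiftPt_pt, zero_add]; simp [va]

lemma va_disj {η : ℝ} {i j : ℤ} (h : i ≠ j) : Disjoint (range (va η i)) (range (va η j)) := by
  rw [Set.disjoint_left]
  rintro _ ⟨s, rfl⟩ ⟨t, e⟩
  have : (va η j t).1 = (va η i s).1 := by rw [e]
  simp only [va, pt_fst] at this
  exact h (by exact_mod_cast this.symm)

lemma idx_eq {X Um : Set Ann} {η : ℝ} (hη : Low X Um η) (k : ℤ) :
    AccIdxB (-1) (pr ⁻¹' Um) (shiftPt k (pt 0 η)) (pt 0 η) k := by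
  refine ⟨Or.inl rfl, va η k, va η (k + 1), va_arc hη k, va_arc hη (k + 1), ?_, ?_,
    va_disj (by omega), ?_⟩
  · rw [va_zero, pt_snd _ le_rfl (by norm_num)]
  · rw [va_zero, pt_snd _ le_rfl (by norm_num)]
  · rw [va_zero, va_zero, pt_fst, pt_fst]; push_cast; linarith

lemma idx_arc {X Um Up : Set Ann} (hX : IsEAC X Um Up) {η : ℝ} (hη : Low X Um η)
    {W : Strip → Strip} (hWX : ∀ z ∈ pr ⁻¹' X, W z ∈ pr ⁻¹' X)
    (hne : ∀ k : ℤ, shiftPt k (pt 0 η) ≠ W (pt 0 η)) {O : Set Strip} {k : ℤ}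
    (h : ArcData Um η W O k) :
    AccIdxB (-1) (pr ⁻¹' Um) (W (pt 0 η)) (pt 0 η) k := by
  obtain ⟨γ, hγ, g0, g1, hr, -⟩ := h
  set g : unitInterval → Strip := fun t => γ t with hg
  have hgI : ∀ t : unitInterval, t ≠ 1 → (t : ℝ) ∈ Ico (0:ℝ) 1 := fun t ht =>
    ⟨t.2.1, lt_of_le_of_ne t.2.2 (fun e => ht (Subtype.ext e))⟩
  have hgarc : IsArcTo (pr ⁻¹' Um) g (W (pt 0 η)) := by
    refine ⟨hγ.cont.comp continuous_subtype_val, ?_, ?_, ?_⟩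
    · intro s t e; exact Subtype.ext (hγ.inj s.2 t.2 e)
    · intro t ht; exact (hr t (hgI t ht)).1
    · simp [hg, g1]
  have hg0 : g 0 = pt (k + 1 / 2) (-1) := by simp [hg, g0]
  have hdis : ∀ j, Disjoint (range g) (range (va η j)) := by
    intro j
    rw [Set.disjoint_left]
    rintro _ ⟨s, rfl⟩ ⟨t, e⟩
    have hc := va_Cuts hη.h1 hη.h2 j t
    rw [e] at hc
    by_cases hs : s = 1
    · rw [hs, hgarc.2.2.2] at hc
      exact not_Cuts hX hη (hWX _ hη.mem) hne hc
    · exact (hr s (hgI s hs)).2 hc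
  refine ⟨Or.inr ⟨va η k, g, va_arc hη k, hgarc, ?_, ?_, (hdis k).symm, ?_⟩,
    g, va η (k + 1), hgarc, va_arc hη (k + 1), ?_, ?_, hdis (k + 1), ?_⟩
  · rw [va_zero, pt_snd _ le_rfl (by norm_num)]
  · rw [hg0, pt_snd _ le_rfl (by norm_num)]
  · rw [va_zero, hg0, pt_fst, pt_fst]; linarith
  · rw [hg0, pt_snd _ le_rfl (by norm_num)]
  · rw [va_zero, pt_snd _ le_rfl (by norm_num)]
  · rw [va_zero, hg0, pt_fst, pt_fst]; push_cast; linarith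

/-- along an access arc, the angle around a cut tip differs from the branch by a constant -/
lemma arc_br {X Um : Set Ann} {η : ℝ} (hη : Low X Um η) (j : ℤ) {A : Strip → ℝ}
    (hA : IsA Um (shiftPt j (pt 0 η)) A) {γ : ℝ → Strip} (hγ : Continuous γ)
    (hr : ∀ t ∈ Ico (0:ℝ) 1, γ t ∈ pr ⁻¹' Um \ Cuts η) {s : ℝ} (hs : s ∈ Ico (0:ℝ) 1) :
    A (γ s) - br (dz (γ s) (shiftPt j (pt 0 η))) = A (γ 0) - br (dz (γ 0) (shiftPt j (pt 0 η))) ∧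
    ((A (γ s) : Real.Angle) = br (dz (γ s) (shiftPt j (pt 0 η)))) ∧
    ((A (γ 0) : Real.Angle) = br (dz (γ 0) (shiftPt j (pt 0 η)))) ∧
    br (dz (γ s) (shiftPt j (pt 0 η))) < 3 * Real.pi / 2 ∧
    br (dz (γ 0) (shiftPt j (pt 0 η))) < 3 * Real.pi / 2 := by
  set P := shiftPt j (pt 0 η) with hP
  have hP1 : P.1 = j := by rw [hP, shiftPt_pt, pt_fst, zero_add]
  have hP2 : (P.2 : ℝ) = η := by rw [hP, shiftPt_pt, pt_snd _ hη.h1.le hη.h2.le]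
  have hslit : ∀ t ∈ Ico (0:ℝ) 1, (dz (γ t) P).re ≠ 0 ∨ 0 < (dz (γ t) P).im := by
    intro t ht
    by_contra hcon
    push Not at hcon
    apply (hr t ht).2
    have e1 : (γ t).1 - P.1 = 0 := hcon.1
    have e2 : ((γ t).2 : ℝ) - P.2 ≤ 0 := hcon.2
    exact ⟨⟨j, by linarith⟩, by linarith⟩
  have hne : ∀ t ∈ Ico (0:ℝ) 1, dz (γ t) P ≠ 0 := by
    intro t ht e
    have := hslit t ht
    rw [e] at this
    simp at this
  have hang : ∀ t ∈ Ico (0:ℝ) 1, (A (γ t) : Real.Angle) = br (dz (γ t) P) := by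
    intro t ht
    rw [br_coe (hne t ht)]
    exact hA.lift _ (hr t ht).1
  have h00 : (0:ℝ) ∈ Ico (0:ℝ) 1 := ⟨le_rfl, by norm_num⟩
  refine ⟨?_, hang s hs, hang 0 h00, br_lt (hslit s hs), br_lt (hslit 0 h00)⟩
  refine lifts_const (A := fun t => A (γ t)) (B := fun t => br (dz (γ t) P)) isPreconnected_Ico
    (hA.cont.comp hγ.continuousOn fun t ht => (hr t ht).1) ?_ hang hs h00
  intro t ht
  have hc : Continuous fun t => dz (γ t) P := continuous_dz.comp (hγ.prodMk continuous_const)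
  exact (ContinuousAt.comp (f := fun t => dz (γ t) P) (br_cont (hslit t ht))
    hc.continuousAt).continuousWithinAt

lemma no_right {X Um Up : Set Ann} (hX : IsEAC X Um Up) {η : ℝ} (hη : Low X Um η) {k : ℤ}
    {A : Strip → ℝ}
    (hA : IsA Um (shiftPt (k + 1) (pt 0 η)) A) {γ : ℝ → Strip} (hγ : Continuous γ)
    (g0 : γ 0 = pt (k + 1 / 2) (-1))
    (hr : ∀ t ∈ Ico (0:ℝ) 1, γ t ∈ pr ⁻¹' Um \ Cuts η) {s : ℝ} (hs : s ∈ Ico (0:ℝ) 1)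
    (h : A (γ s) ∈ Ioo (-(Real.pi / 2)) (Real.pi / 2)) : False := by
  obtain ⟨e, hang, -, hlt, -⟩ := arc_br hη (k + 1) hA hγ hr hs
  have h1 := br_gt (dz (γ s) (shiftPt (k + 1) (pt 0 η)))
  have h2 := br_gt (dz (γ 0) (shiftPt (k + 1) (pt 0 η)))
  have := angle_eq_of_lt hang (by rw [abs_lt]; constructor <;> linarith [h.1, h.2, Real.pi_pos])
  have h3 := hA.left (S := {γ 0}) isPreconnected_singleton
    (by rw [g0]; exact singleton_subset_iff.2 (bot_mem hX _))
    (by rw [g0]; rintro w rfl; rw [shiftPt_pt, pt_fst, pt_fst]; push_cast; linarith)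
    (x := k + 1 / 2) (by rw [g0]; rfl) rfl
  linarith [h3.2]

lemma no_left {X Um Up : Set Ann} (hX : IsEAC X Um Up) {η : ℝ} (hη : Low X Um η) {k : ℤ}
    {A : Strip → ℝ}
    (hA : IsA Um (shiftPt k (pt 0 η)) A) {γ : ℝ → Strip} (hγ : Continuous γ)
    (g0 : γ 0 = pt (k + 1 / 2) (-1))
    (hr : ∀ t ∈ Ico (0:ℝ) 1, γ t ∈ pr ⁻¹' Um \ Cuts η) {s : ℝ} (hs : s ∈ Ico (0:ℝ) 1)
    (h : A (γ s) ∈ Ioo (-(3 * Real.pi / 2)) (-(Real.pi / 2))) : False := by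
  obtain ⟨e, -, hang, -, hlt⟩ := arc_br hη k hA hγ hr hs
  have h1 := br_gt (dz (γ s) (shiftPt k (pt 0 η)))
  have h2 := br_gt (dz (γ 0) (shiftPt k (pt 0 η)))
  have h3 := hA.right (S := {γ 0}) isPreconnected_singleton
    (by rw [g0]; exact singleton_subset_iff.2 (bot_mem hX _))
    (by rw [g0]; rintro w rfl; rw [shiftPt_pt, pt_fst, pt_fst]; linarith)
    (x := k + 1 / 2) (by rw [g0]; rfl) rfl
  have := angle_eq_of_lt hang (by rw [abs_lt]; constructor <;> linarith [h3.1, h3.2, Real.pi_pos])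
  linarith [h.2]

/-- the neighbourhood of points that shadow the orbit -/
def Shadow (F : Strip → Strip) (x : Strip) (n : ℕ) : Set Strip :=
  {z | ∀ i ∈ Finset.range (n + 1), |(F^[i] z).1 - (F^[i] x).1| < 1}

lemma isOpen_Shadow {F : Strip → Strip} (hF : Continuous F) (x : Strip) (n : ℕ) :
    IsOpen (Shadow F x n) := by
  have : Shadow F x n = ⋂ i ∈ Finset.range (n + 1), {z | |(F^[i] z).1 - (F^[i] x).1| < 1} := by
    ext z; simp [Shadow]
  rw [this]
  refine isOpen_biInter_finset fun i _ => ?_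
  exact isOpen_lt ((((continuous_fst.comp (hF.iterate i)).sub continuous_const)).abs)
    continuous_const

lemma main_alt {f : Ann → Ann} (hfi : Injective f) {F : Strip ≃ₜ Strip}
    (hF : IsLift f ⇑F) {X Um Up : Set Ann} (hX : IsEAC X Um Up) (hinv : f '' X = X)
    {M : ℝ} (hM : 0 ≤ M) (hT : Transp F M) (hU : ∀ z ∈ pr ⁻¹' Um, F z ∈ pr ⁻¹' Um)
    {η : ℝ} (hη : Low X Um η) {n : ℕ} {k : ℤ}
    (hk : shiftPt k (pt 0 η) = F^[n] (pt 0 η) ∨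
      ArcData Um η (F^[n]) (Shadow F (pt 0 η) n) k) {D : ℝ} :
    ((∀ w ∈ pr ⁻¹' X, D ≤ (F^[n] w).1 - w.1) → D - 1 - (k + 1) ≤ 2 * M) ∧
    ((∀ w ∈ pr ⁻¹' X, (F^[n] w).1 - w.1 ≤ D) → -(2 * M) ≤ D + 1 - k) := by
  have hiff : ∀ (m : ℕ) (z : Strip), F^[m] z ∈ pr ⁻¹' X ↔ z ∈ pr ⁻¹' X := by
    intro m
    induction m with
    | zero => intro z; exact Iff.rfl
    | succ m ih => intro z; rw [iterate_succ_apply, ih, F_Xt_iff hfi hF hinv]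
  obtain ⟨y, hy⟩ := (F.surjective.iterate n) (pt 0 η)
  have hyX : y ∈ pr ⁻¹' X := by rw [← hiff n, hy]; exact hη.mem
  have hswap : ∀ i, F^[n] (F^[i] y) = F^[i] (pt 0 η) := by
    intro i
    rw [← iterate_add_apply, Nat.add_comm, iterate_add_apply, hy]
  rcases hk with hk | ⟨γ, hγ, g0, g1, hr, s, hs, t, ht1, htη, htO, es⟩
  · have hx1 : (F^[n] (pt 0 η)).1 = k := by rw [← hk, shiftPt_pt, pt_fst, zero_add]
    constructor
    · intro h
      have := h _ hη.mem
      rw [hx1, pt_fst] at this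
      linarith
    · intro h
      have := h _ hη.mem
      rw [hx1, pt_fst] at this
      linarith
  have hzU : pt 0 t ∈ pr ⁻¹' Um := hη.below t ht1 htη
  have hvert : (fun y => pt 0 y) '' Icc (-1) t ⊆ pr ⁻¹' Um := by
    rintro _ ⟨u, hu, rfl⟩
    exact hη.below u hu.1 (by linarith [hu.2])
  have hsh : ∀ i ≤ n, |(F^[i] (pt 0 t)).1 - (F^[i] (pt 0 η)).1| < 1 := fun i hi =>
    htO i (Finset.mem_range.2 (by omega))
  have hQi : ∀ (j : ℤ) (i : ℕ), (F^[i] (shiftPt j y)).1 = (F^[i] y).1 + j := by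
    intro j i; rw [iter_shift hF]; rfl
  have hQn : ∀ j : ℤ, F^[n] (shiftPt j y) = shiftPt j (pt 0 η) := by
    intro j; rw [iter_shift hF, hy]
  constructor
  · intro h
    by_contra hcon
    push Not at hcon
    have hsep : ∀ i ≤ n, 2 * M < (F^[i] (pt 0 t)).1 - (F^[i] (shiftPt (k + 1) y)).1 := by
      intro i hi
      have h1 := h (F^[i] y) ((hiff i y).2 hyX)
      rw [hswap] at h1
      have h2 := (abs_lt.1 (hsh i hi)).1
      rw [hQi]; push_cast; linarith
    obtain ⟨A, hA⟩ := exists_IsA hX ((hiff n (shiftPt (k + 1) y)).2 ((mem_shift _).2 hyX))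
    have key := n_steps_right hF hX hinv hT hU ((mem_shift (k + 1)).2 hyX) hzU n (by
      intro B hB
      refine hB.right (vert_preconn 0 (-1) t) hvert ?_ ⟨-1, ⟨le_rfl, ht1⟩, rfl⟩
        ⟨t, ⟨ht1, le_rfl⟩, rfl⟩
      rintro _ ⟨u, hu, rfl⟩
      have := hsep 0 (Nat.zero_le _)
      simp only [iterate_zero, id, pt_fst] at this ⊢
      linarith) (fun i hi => hsep i hi.le) A hA
    rw [hQn] at hA
    rw [← es] at key
    exact no_right hX hη hA hγ.cont g0 hr hs key
  · intro h
    by_contra hcon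
    push Not at hcon
    have hsep : ∀ i ≤ n, (F^[i] (pt 0 t)).1 - (F^[i] (shiftPt k y)).1 < -(2 * M) := by
      intro i hi
      have h1 := h (F^[i] y) ((hiff i y).2 hyX)
      rw [hswap] at h1
      have h2 := (abs_lt.1 (hsh i hi)).2
      rw [hQi]; linarith
    obtain ⟨A, hA⟩ := exists_IsA hX ((hiff n (shiftPt k y)).2 ((mem_shift _).2 hyX))
    have key := n_steps_left hF hX hinv hT hU ((mem_shift k).2 hyX) hzU n (by
      intro B hB
      refine hB.left (vert_preconn 0 (-1) t) hvert ?_ ⟨-1, ⟨le_rfl, ht1⟩, rfl⟩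
        ⟨t, ⟨ht1, le_rfl⟩, rfl⟩
      rintro _ ⟨u, hu, rfl⟩
      have := hsep 0 (Nat.zero_le _)
      simp only [iterate_zero, id, pt_fst] at this ⊢
      linarith) (fun i hi => hsep i hi.le) A hA
    rw [hQn] at hA
    rw [← es] at key
    exact no_left hX hη hA hγ.cont g0 hr hs key

lemma ev_big {ρ a c : ℝ} {k : ℕ → ℤ} (hk : Tendsto (fun n : ℕ => (k n : ℝ) / (n : ℝ)) atTop (𝓝 ρ))
    (ha : ρ < a) : ∃ n : ℕ, c < a * n - k n := by
  have h1 : ∀ᶠ n : ℕ in atTop, (k n : ℝ) / n < (a + ρ) / 2 :=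
    hk.eventually_lt_const (by linarith)
  have h2 : Tendsto (fun n : ℕ => (n : ℝ) * ((a - ρ) / 2)) atTop atTop :=
    tendsto_natCast_atTop_atTop.atTop_mul_const (by linarith)
  obtain ⟨n, ⟨h3, h4⟩, h5⟩ := ((h1.and (h2.eventually_gt_atTop c)).and (eventually_gt_atTop 0)).exists
  have hn : (0:ℝ) < n := by exact_mod_cast h5
  rw [div_lt_iff₀ hn] at h3
  exact ⟨n, by linarith⟩

/-- Matsumoto: the lower prime end rotation number is a measure rotation number. -/
theorem matsumoto_lower
    (f : Ann ≃ₜ Ann) (hf : IsotopicToId ⇑f)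
    (F : Strip ≃ₜ Strip) (hF : IsLift ⇑f ⇑F)
    (X Um Up : Set Ann) (hX : IsEAC X Um Up) (hinv : ⇑f '' X = X)
    (φ : Ann → ℝ) (hφc : Continuous φ)
    (hφ : ∀ z : Strip, φ (pr z) = (F z).1 - z.1)
    (ρm : ℝ)
    (hrot : PrimeEndRotB (-1) (pr ⁻¹' Um) (pr ⁻¹' X) ⇑F ρm) :
    ρm ∈ rotMes ⇑f φ X := by
  by_contra hcon
  obtain ⟨M, hM, hT⟩ := transport hf F.continuous hF
  have hU := no_swap f.injective hF hX hinv hT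
  obtain ⟨η, h1, h2, h3, h4⟩ := exists_low hX 0
  have hη : Low X Um η := ⟨h1, h2, h3, h4⟩
  have hWX : ∀ n, ∀ z ∈ pr ⁻¹' X, F^[n] z ∈ pr ⁻¹' X := fun n z hz =>
    iter_Um (fun z hz => F_Xt hF hinv hz) n hz
  have hex : ∀ n : ℕ, ∃ k : ℤ, AccIdxB (-1) (pr ⁻¹' Um) (F^[n] (pt 0 η)) (pt 0 η) k ∧
      (shiftPt k (pt 0 η) = F^[n] (pt 0 η) ∨
        ArcData Um η (F^[n]) (Shadow F (pt 0 η) n) k) := by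
    intro n
    by_cases hne : ∃ k : ℤ, shiftPt k (pt 0 η) = F^[n] (pt 0 η)
    · obtain ⟨k, hk⟩ := hne
      refine ⟨k, ?_, Or.inl hk⟩
      rw [← hk]; exact idx_eq hη k
    · push Not at hne
      obtain ⟨k, hk⟩ := index_arc hX hη (F.continuous.iterate n) (F.injective.iterate n) (hWX n)
        (fun z hz => iter_Um hU n hz) hne (isOpen_Shadow F.continuous (pt 0 η) n)
        (fun i _ => by simp)
      exact ⟨k, idx_arc hX hη (hWX n) hne hk, Or.inr hk⟩
  choose k hk1 hk2 using hex
  have hacc : AccFrom (pr ⁻¹' Um) (pt 0 η) := by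
    refine ⟨va η 0, ?_⟩
    have := va_arc hη 0
    rwa [shiftPt_zero] at this
  have hlim := hrot _ hη.mem _ hη.mem hacc hacc k hk1
  rcases measure_alt f.continuous hX.compact hinv hF hφc hφ hcon with
    ⟨a, ha, C, hC⟩ | ⟨a, ha, C, hC⟩
  · obtain ⟨n, hn⟩ := ev_big (c := 2 * M + C + 2) hlim ha
    have := (main_alt f.injective hF hX hinv hM hT hU hη (hk2 n)).1 (hC n)
    linarith
  · have hlim' : Tendsto (fun n : ℕ => ((-k n : ℤ) : ℝ) / (n : ℝ)) atTop (𝓝 (-ρm)) := by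
      refine hlim.neg.congr fun n => ?_
      push_cast; ring
    obtain ⟨n, hn⟩ := ev_big (c := 2 * M + C + 1) (a := -a) hlim' (by linarith)
    have := (main_alt f.injective hF hX hinv hM hT hU hη (hk2 n)).2 (hC n)
    push_cast at hn
    linarith
end

section
/- Let X ⊂ int(𝔸) be an f-invariant essential annular continuum with inf ρ_mes(f̃, X) > 0. Then there exists an integer m ≥ 1 such that (f̃^m(x))₁ ≥ (x)₁ + 1 for every x ∈ X̃. -/
open Set Function MeasureTheory Filter Topology

/-- The empirical measure of the first `n + 1` points of the orbit of `x`. -/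
noncomputable def empMeas (g : Ann → Ann) (n : ℕ) (x : Ann) : Measure Ann :=
  ((n : ENNReal) + 1)⁻¹ • ∑ i ∈ Finset.range (n + 1), Measure.dirac (g^[i] x)

theorem empMeas_prob (g : Ann → Ann) (n : ℕ) (x : Ann) :
    IsProbabilityMeasure (empMeas g n x) := by
  constructor
  simp only [empMeas, Measure.smul_apply, Measure.finsetSum_apply, measure_univ,
    Finset.sum_const, Finset.card_range, smul_eq_mul, nsmul_eq_mul, mul_one]
  push_cast
  exact ENNReal.inv_mul_cancel (by simp) (by simp)

theorem empMeas_integral (g : Ann → Ann) (n : ℕ) (x : Ann) (ψ : Ann → ℝ) (hψ : Continuous ψ) :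
    ∫ a, ψ a ∂(empMeas g n x) = ((n : ℝ) + 1)⁻¹ * birkhoffSum g ψ (n + 1) x := by
  rw [empMeas, integral_smul_measure, integral_finsetSum_measure]
  · have h : (((n : ENNReal) + 1)⁻¹).toReal = ((n : ℝ) + 1)⁻¹ := by
      rw [ENNReal.toReal_inv, ENNReal.toReal_add (by simp) (by simp)]
      simp
    simp [h, birkhoffSum, integral_dirac]
  · intro i _
    exact hψ.integrable_of_hasCompactSupport (HasCompactSupport.of_compactSpace ψ)

/-- Krylov--Bogolyubov: uniform positivity of the Birkhoff sums. -/
theorem exists_birkhoffSum_ge_one (f : Ann ≃ₜ Ann) (X : Set Ann) (hXc : IsClosed X)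
    (hinv : ∀ x ∈ X, f x ∈ X) (φ : Ann → ℝ) (hφc : Continuous φ)
    (hpos : ∀ r ∈ rotMes f φ X, 0 < r) :
    ∃ n : ℕ, ∀ x ∈ X, 1 ≤ birkhoffSum f φ (n + 1) x := by
  by_contra! hcon
  choose x hxX hx using hcon
  let ν : ℕ → ProbabilityMeasure Ann := fun n => ⟨empMeas f n (x n), empMeas_prob f n (x n)⟩
  let L : Ultrafilter ℕ := hyperfilter ℕ
  have hL : (L : Filter ℕ) ≤ atTop := by
    rw [← Nat.cofinite_eq_atTop]; exact hyperfilter_le_cofinite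
  obtain ⟨μ, -, hμ⟩ := isCompact_univ.ultrafilter_le_nhds (L.map ν) (by simp)
  have hT : Tendsto ν L (𝓝 μ) := hμ
  have hint := ProbabilityMeasure.tendsto_iff_forall_integral_tendsto.1 hT
  have key : ∀ ψ : Ann → ℝ, Continuous ψ → Tendsto
      (fun n : ℕ => ((n : ℝ) + 1)⁻¹ * birkhoffSum f ψ (n + 1) (x n)) L
        (𝓝 (∫ a, ψ a ∂(μ : Measure Ann))) := by
    intro ψ hψ
    have h := hint (BoundedContinuousFunction.mkOfCompact ⟨ψ, hψ⟩)
    refine h.congr fun n => ?_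
    exact empMeas_integral f n (x n) ψ hψ
  have hinv0 : Tendsto (fun n : ℕ => ((n : ℝ) + 1)⁻¹) L (𝓝 0) := by
    have h := (tendsto_one_div_add_atTop_nhds_zero_nat (𝕜 := ℝ)).mono_left hL
    simpa using h
  have hle : ∫ a, φ a ∂(μ : Measure Ann) ≤ 0 := by
    refine le_of_tendsto_of_tendsto (key φ hφc) hinv0 (Eventually.of_forall fun n => ?_)
    have : (0 : ℝ) < ((n : ℝ) + 1)⁻¹ := by positivity
    show ((n : ℝ) + 1)⁻¹ * birkhoffSum f φ (n + 1) (x n) ≤ ((n : ℝ) + 1)⁻¹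
    nlinarith [hx n]
  have hmap : Measure.map f (μ : Measure Ann) = μ := by
    haveI : IsProbabilityMeasure (Measure.map f (μ : Measure Ann)) :=
      Measure.isProbabilityMeasure_map f.continuous.measurable.aemeasurable
    apply ext_of_forall_integral_eq_of_IsFiniteMeasure
    intro ψ
    rw [integral_map f.continuous.measurable.aemeasurable
      ψ.continuous.aestronglyMeasurable]
    have h1 := key (fun a => ψ (f a)) (ψ.continuous.comp f.continuous)
    have h2 := key ψ ψ.continuous
    have h3 := h1.sub h2
    have h4 : Tendsto (fun n : ℕ => ((n : ℝ) + 1)⁻¹ * (2 * ‖ψ‖)) L (𝓝 0) := by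
      simpa using hinv0.mul_const (2 * ‖ψ‖)
    have h5 := squeeze_zero_norm (f := fun n : ℕ =>
      ((n : ℝ) + 1)⁻¹ * birkhoffSum f (fun a => ψ (f a)) (n + 1) (x n) -
      ((n : ℝ) + 1)⁻¹ * birkhoffSum f ψ (n + 1) (x n)) (fun n => ?_) h4
    · have := tendsto_nhds_unique h3 h5
      linarith
    · have e : birkhoffSum f (fun a => ψ (f a)) (n + 1) (x n)
          = birkhoffSum f ψ (n + 1) (f (x n)) := by
        simp only [birkhoffSum]
        refine Finset.sum_congr rfl fun i _ => ?_
        rw [← Function.iterate_succ_apply' f i, Function.iterate_succ_apply]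
      rw [e, ← mul_sub, birkhoffSum_apply_sub_birkhoffSum, norm_mul]
      have : (0 : ℝ) < ((n : ℝ) + 1)⁻¹ := by positivity
      rw [Real.norm_of_nonneg this.le]
      refine mul_le_mul_of_nonneg_left ?_ this.le
      have := norm_sub_le (ψ (f^[n + 1] (x n))) (ψ (x n))
      linarith [ψ.norm_coe_le_norm (f^[n + 1] (x n)), ψ.norm_coe_le_norm (x n)]
  have hiter : ∀ i : ℕ, ∀ y ∈ X, f^[i] y ∈ X := by
    intro i
    induction i with
    | zero => intro y hy; exact hy
    | succ k ih => intro y hy; rw [Function.iterate_succ_apply]; exact ih _ (hinv y hy)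
  have hsupp : (μ : Measure Ann) Xᶜ = 0 := by
    have h := ProbabilityMeasure.le_liminf_measure_open_of_tendsto hT hXc.isOpen_compl
    have hz : ∀ n, (ν n : Measure Ann) Xᶜ = 0 := by
      intro n
      show empMeas f n (x n) Xᶜ = 0
      simp only [empMeas, Measure.smul_apply, Measure.finsetSum_apply, smul_eq_mul]
      rw [Finset.sum_eq_zero, mul_zero]
      intro i _
      rw [Measure.dirac_apply' _ hXc.isOpen_compl.measurableSet]
      simp [hiter i _ (hxX n)]
    simp only [hz] at h
    simpa using h
  exact absurd (hpos _ ⟨μ, inferInstance, hmap, hsupp, rfl⟩) (not_lt.2 hle)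

theorem iterate_lift (f : Ann → Ann) (F : Strip → Strip) (hF : ∀ z, pr (F z) = f (pr z))
    (φ : Ann → ℝ) (hφ : ∀ z : Strip, φ (pr z) = (F z).1 - z.1) (n : ℕ) (z : Strip) :
    (F^[n] z).1 = z.1 + birkhoffSum f φ n (pr z) := by
  induction n generalizing z with
  | zero => simp
  | succ k ih =>
    rw [Function.iterate_succ_apply, ih, birkhoffSum_succ', hF, hφ]
    ring

/-- first part of Lemma `aladerecha`: if `inf ρ_mes(f̃, X) > 0` then some
iterate `f̃^m` displaces every point of `X̃` to the right by at least `1`. -/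
theorem exists_iterate_displacement
    (f : Ann ≃ₜ Ann) (hf : IsotopicToId ⇑f)
    (F : Strip ≃ₜ Strip) (hF : IsLift ⇑f ⇑F)
    (X Um Up : Set Ann) (hX : IsEAC X Um Up) (hinv : ⇑f '' X = X)
    (φ : Ann → ℝ) (hφc : Continuous φ)
    (hφ : ∀ z : Strip, φ (pr z) = (F z).1 - z.1)
    (hpos : 0 < sInf (rotMes ⇑f φ X)) :
    ∃ m : ℕ, 1 ≤ m ∧ ∀ z ∈ pr ⁻¹' X, ((⇑F)^[m] z).1 ≥ z.1 + 1 := by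
  have hbdd : BddBelow (rotMes f φ X) := by
    by_contra h
    rw [Real.sInf_of_not_bddBelow h] at hpos
    exact lt_irrefl _ hpos
  obtain ⟨n, hn⟩ := exists_birkhoffSum_ge_one f X hX.compact.isClosed
    (fun x hx => hinv ▸ Set.mem_image_of_mem f hx) φ hφc
    (fun r hr => hpos.trans_le (csInf_le hbdd hr))
  refine ⟨n + 1, by omega, fun z hz => ?_⟩
  rw [iterate_lift f F hF.1 φ hφ]
  linarith [hn (pr z) hz]
end
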